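/- arXiv:1007.0672 — 4 statements merged into one kernel-verified Lean document; each statement's English description precedes it below -/
import Mathlib

section
/- Let W ⊆ ℂ² be open, let α, β : [0,1] → W be piecewise continuously differentiable paths with α(1) = β(0), and let α⋆β : [0,1] → W denote their concatenation, defined by (α⋆β)(s) = α(2s) for s ∈ [0,1/2] and (α⋆β)(s) = β(2s−1) for s ∈ [1/2,1]. Then for any holomorphic 1-forms ω₁, …, ω_k on W one has the composition formula ∫_{α⋆β} ω₁⋯ω_k = Σ_{i=0}^{k} (∫_β ω₁⋯ω_i)·(∫_α ω_{i+1}⋯ω_k), where the iterated integral of the empty list of forms equals 1. (This is the multiplicativity of the Chen map: φ(δ₁δ₂) = φ(δ₁)φ(δ₂).) -/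
/-- A 1-form `P dx + Q dy` on `ℂ²` (with coordinates `(x, y)`),
given by its pair of coefficient functions `(P, Q)`. -/
abbrev Form1 : Type := ((ℂ × ℂ) → ℂ) × ((ℂ × ℂ) → ℂ)

/-- `ω` is a holomorphic 1-form on `W`. -/
def HolFormOn (W : Set (ℂ × ℂ)) (ω : Form1) : Prop :=
  DifferentiableOn ℂ ω.1 W ∧ DifferentiableOn ℂ ω.2 W

/-- The pullback `γ*ω` of the 1-form `ω = P dx + Q dy` along a path `γ = (γ₁, γ₂)`:
`(γ*ω)(s) = P(γ(s))·γ₁′(s) + Q(γ(s))·γ₂′(s)`. -/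
noncomputable def pull (γ : ℝ → ℂ × ℂ) (ω : Form1) (s : ℝ) : ℂ :=
  ω.1 (γ s) * deriv (fun u => (γ u).1) s + ω.2 (γ s) * deriv (fun u => (γ u).2) s

/-- The iterated integral `I(γ; ω₁,…,ω_k; s)`, defined recursively:
`I(γ; ; s) = 1` and `I(γ; ω₁,…,ω_k; s) = ∫₀^s (γ*ω₁)(u) · I(γ; ω₂,…,ω_k; u) du`.
The iterated integral `∫_γ ω₁⋯ω_k` is `iterInt γ [ω₁,…,ω_k] 1`. -/
noncomputable def iterInt (γ : ℝ → ℂ × ℂ) : List Form1 → ℝ → ℂ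
  | [], _ => 1
  | ω :: ωs, s => ∫ u in (0:ℝ)..s, pull γ ω u * iterInt γ ωs u

/-- `γ : [0,1] → ℂ²` is a piecewise continuously differentiable path. -/
def PiecewiseC1 (γ : ℝ → ℂ × ℂ) : Prop :=
  ContinuousOn γ (Set.Icc 0 1) ∧
  ∃ (n : ℕ) (t : Fin (n + 1) → ℝ), StrictMono t ∧ t 0 = 0 ∧ t (Fin.last n) = 1 ∧
    ∀ i : Fin n, ContDiffOn ℝ 1 γ (Set.Icc (t i.castSucc) (t i.succ))

/-- The concatenation `α⋆β` of two paths: first `α` (at double speed), then `β`. -/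
noncomputable def concat (α β : ℝ → ℂ × ℂ) : ℝ → ℂ × ℂ :=
  fun s => if s ≤ 1 / 2 then α (2 * s) else β (2 * s - 1)

open MeasureTheory Set in
theorem ContDiffOn.intervalIntegrable_deriv {f : ℝ → ℂ} {a b : ℝ} (hab : a < b)
    (hf : ContDiffOn ℝ 1 f (Icc a b)) : IntervalIntegrable (deriv f) volume a b := by
  have hd : ContinuousOn (derivWithin f (Icc a b)) (Icc a b) :=
    hf.continuousOn_derivWithin (uniqueDiffOn_Icc hab) le_rfl
  refine (hd.intervalIntegrable_of_Icc hab.le).congr_uIoo fun x hx => ?_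
  rw [uIoo_of_le hab.le] at hx
  exact derivWithin_of_mem_nhds (Icc_mem_nhds hx.1 hx.2)

namespace PiecewiseC1

open MeasureTheory Set

variable {γ : ℝ → ℂ × ℂ} {W : Set (ℂ × ℂ)}

theorem intervalIntegrable_pull (hγ : PiecewiseC1 γ) (hγW : ∀ s ∈ Icc (0 : ℝ) 1, γ s ∈ W)
    {ω : Form1} (hω : HolFormOn W ω) : IntervalIntegrable (pull γ ω) volume 0 1 := by
  obtain ⟨hc, n, t, ht, h0, h1, hC⟩ := hγ
  suffices h : ∀ i, IntervalIntegrable (pull γ ω) volume 0 (t i) from h1 ▸ h (Fin.last n)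
  intro i
  induction i using Fin.induction with
  | zero => simp [h0]
  | succ i ih =>
    refine ih.trans ?_
    have hlt : t i.castSucc < t i.succ := ht i.castSucc_lt_succ
    have hsub : Icc (t i.castSucc) (t i.succ) ⊆ Icc 0 1 :=
      Icc_subset_Icc (h0 ▸ ht.monotone (Fin.zero_le _)) (h1 ▸ ht.monotone (Fin.le_last _))
    have hcoef : ∀ P : ℂ × ℂ → ℂ, DifferentiableOn ℂ P W →
        ContinuousOn (fun s => P (γ s)) (uIcc (t i.castSucc) (t i.succ)) := fun P hP => by
      rw [uIcc_of_le hlt.le]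
      exact (hP.continuousOn.comp hc hγW).mono hsub
    exact ((hC i).fst.intervalIntegrable_deriv hlt |>.continuousOn_mul (hcoef _ hω.1)).add
      ((hC i).snd.intervalIntegrable_deriv hlt |>.continuousOn_mul (hcoef _ hω.2))

theorem continuousOn_iterInt (hγ : PiecewiseC1 γ) (hγW : ∀ s ∈ Icc (0 : ℝ) 1, γ s ∈ W)
    (L : List Form1) (hL : ∀ ω ∈ L, HolFormOn W ω) :
    ContinuousOn (iterInt γ L) (uIcc 0 1) := by
  induction L with
  | nil => exact continuousOn_const
  | cons ω L ih =>
    exact intervalIntegral.continuousOn_primitive_interval'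
      ((hγ.intervalIntegrable_pull hγW (hL ω List.mem_cons_self)).mul_continuousOn
        (ih fun η hη => hL η (List.mem_cons_of_mem _ hη))) left_mem_uIcc

theorem intervalIntegrable_pull_mul_iterInt (hγ : PiecewiseC1 γ)
    (hγW : ∀ s ∈ Icc (0 : ℝ) 1, γ s ∈ W) {ω : Form1} (hω : HolFormOn W ω)
    (L : List Form1) (hL : ∀ ω ∈ L, HolFormOn W ω) :
    IntervalIntegrable (fun u => pull γ ω u * iterInt γ L u) volume 0 1 :=
  (hγ.intervalIntegrable_pull hγW hω).mul_continuousOn (hγ.continuousOn_iterInt hγW L hL)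

end PiecewiseC1

section Concat

open MeasureTheory Set

theorem pull_congr {γ δ : ℝ → ℂ × ℂ} {s : ℝ} (h : γ =ᶠ[nhds s] δ) (ω : Form1) :
    pull γ ω s = pull δ ω s := by
  have h₁ : (fun u => (γ u).1) =ᶠ[nhds s] fun u => (δ u).1 := h.fun_comp Prod.fst
  have h₂ : (fun u => (γ u).2) =ᶠ[nhds s] fun u => (δ u).2 := h.fun_comp Prod.snd
  simp only [pull, h.eq_of_nhds, h₁.deriv_eq, h₂.deriv_eq]

theorem deriv_comp_mul_sub {E : Type*} [NormedAddCommGroup E] [NormedSpace ℝ E]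
    (f : ℝ → E) (c d s : ℝ) : deriv (fun u => f (c * u - d)) s = c • deriv f (c * s - d) := by
  rw [deriv_comp_mul_left c (fun u => f (u - d)) s, deriv_comp_sub_const]

theorem pull_comp_mul_sub (γ : ℝ → ℂ × ℂ) (ω : Form1) (c d s : ℝ) :
    pull (fun u => γ (c * u - d)) ω s = c * pull γ ω (c * s - d) := by
  simp only [pull, deriv_comp_mul_sub (fun u => (γ u).1), deriv_comp_mul_sub (fun u => (γ u).2),
    Complex.real_smul]
  ring

variable (α β : ℝ → ℂ × ℂ)

theorem pull_concat_of_lt (ω : Form1) {s : ℝ} (hs : s < 1 / 2) :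
    pull (concat α β) ω s = 2 * pull α ω (2 * s) := by
  have h : concat α β =ᶠ[nhds s] fun u => α (2 * u - 0) := by
    filter_upwards [Iio_mem_nhds hs] with u hu
    rw [sub_zero]
    exact if_pos (mem_Iio.1 hu).le
  rw [pull_congr h, pull_comp_mul_sub]
  simp

theorem pull_concat_of_gt (ω : Form1) {s : ℝ} (hs : 1 / 2 < s) :
    pull (concat α β) ω s = 2 * pull β ω (2 * s - 1) := by
  have h : concat α β =ᶠ[nhds s] fun u => β (2 * u - 1) := by
    filter_upwards [Ioi_mem_nhds hs] with u hu
    exact if_neg (not_le.2 hu)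
  rw [pull_congr h, pull_comp_mul_sub]
  simp

theorem iterInt_concat_of_le (L : List Form1) {s : ℝ} (hs : s ≤ 1 / 2) :
    iterInt (concat α β) L s = iterInt α L (2 * s) := by
  induction L generalizing s with
  | nil => rfl
  | cons ω L ih =>
    have h : EqOn (fun u => pull (concat α β) ω u * iterInt (concat α β) L u)
        (fun u => (2 : ℂ) * (pull α ω (2 * u) * iterInt α L (2 * u))) (uIoo 0 s) := fun u hu => by
      have hu' : u < 1 / 2 := hu.2.trans_le (max_le (by norm_num) hs)
      simp only [pull_concat_of_lt α β ω hu', ih hu'.le, mul_assoc]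
    simp only [iterInt]
    rw [intervalIntegral.integral_congr_uIoo h, intervalIntegral.integral_const_mul,
      intervalIntegral.integral_comp_mul_left (fun u => pull α ω u * iterInt α L u) two_ne_zero]
    simp

variable {α β} {W : Set (ℂ × ℂ)}

theorem iterInt_concat_of_ge (hα : PiecewiseC1 α) (hβ : PiecewiseC1 β)
    (hαW : ∀ s ∈ Icc (0 : ℝ) 1, α s ∈ W) (hβW : ∀ s ∈ Icc (0 : ℝ) 1, β s ∈ W)
    (L : List Form1) (hL : ∀ ω ∈ L, HolFormOn W ω) {s : ℝ} (hs : s ∈ Icc (1 / 2 : ℝ) 1) :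
    iterInt (concat α β) L s
      = ∑ i ∈ Finset.range (L.length + 1),
          iterInt β (L.take i) (2 * s - 1) * iterInt α (L.drop i) 1 := by
  induction L generalizing s with
  | nil => simp [iterInt]
  | cons ω L ih =>
    have hω := hL ω List.mem_cons_self
    have hL' : ∀ η ∈ L, HolFormOn W η := fun η hη => hL η (List.mem_cons_of_mem _ hη)
    have hs' : 2 * s - 1 ∈ Icc (0 : ℝ) 1 := ⟨by linarith [hs.1], by linarith [hs.2]⟩
    set f : ℝ → ℂ := fun u => pull (concat α β) ω u * iterInt (concat α β) L u with hf
    set g : ℝ → ℂ := fun u => ∑ i ∈ Finset.range (L.length + 1),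
      pull β ω u * iterInt β (L.take i) u * iterInt α (L.drop i) 1 with hg
    have hterm : ∀ i ∈ Finset.range (L.length + 1), IntervalIntegrable
        (fun u => pull β ω u * iterInt β (L.take i) u * iterInt α (L.drop i) 1)
        volume 0 (2 * s - 1) := fun i _ =>
      ((hβ.intervalIntegrable_pull_mul_iterInt hβW hω (L.take i)
        fun η hη => hL' η (List.mem_of_mem_take hη)).mono_set
          (uIcc_subset_uIcc left_mem_uIcc (by rwa [uIcc_of_le zero_le_one]))).mul_const _
    have hfg : EqOn f (fun u => 2 * g (2 * u - 1)) (uIoo (1 / 2) s) := fun u hu => by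
      rw [uIoo_of_le hs.1] at hu
      simp only [hf, hg, pull_concat_of_gt α β ω hu.1, ih hL' ⟨hu.1.le, hu.2.le.trans hs.2⟩,
        Finset.mul_sum]
      exact Finset.sum_congr rfl fun i _ => by ring
    have hfα : EqOn (fun u => 2 * (pull α ω (2 * u) * iterInt α L (2 * u))) f
        (uIoo 0 (1 / 2)) := fun u hu => by
      rw [uIoo_of_le (by norm_num)] at hu
      simp only [hf, pull_concat_of_lt α β ω hu.2, iterInt_concat_of_le α β L hu.2.le, mul_assoc]
    have hint₁ : IntervalIntegrable f volume 0 (1 / 2) := by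
      have h := (hα.intervalIntegrable_pull_mul_iterInt hαW hω L hL').comp_mul_left (c := 2)
      rw [zero_div] at h
      exact (h.const_mul 2).congr_uIoo hfα
    have hint₂ : IntervalIntegrable f volume (1 / 2) s := by
      have h : IntervalIntegrable g volume 0 (2 * s - 1) := by
        simpa only [hg, Finset.sum_fn] using IntervalIntegrable.sum _ hterm
      have h' := (h.comp_sub_right 1).comp_mul_left (c := 2)
      rw [zero_add, sub_add_cancel, mul_div_cancel_left₀ s two_ne_zero] at h'
      exact (h'.const_mul 2).congr_uIoo hfg.symm
    have hfirst : ∫ u in (0 : ℝ)..(1 / 2), f u = iterInt α (ω :: L) 1 := by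
      have h := iterInt_concat_of_le α β (ω :: L) le_rfl
      rwa [mul_one_div_cancel two_ne_zero] at h
    have hsecond : ∫ u in (1 / 2)..s, f u = ∫ u in (0 : ℝ)..(2 * s - 1), g u := by
      rw [intervalIntegral.integral_congr_uIoo hfg, intervalIntegral.integral_const_mul,
        intervalIntegral.integral_comp_mul_sub g two_ne_zero]
      simp
    calc iterInt (concat α β) (ω :: L) s
        = (∫ u in (0 : ℝ)..(1 / 2), f u) + ∫ u in (1 / 2)..s, f u :=
          (intervalIntegral.integral_add_adjacent_intervals hint₁ hint₂).symm
      _ = _ := by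
          rw [hfirst, hsecond, intervalIntegral.integral_finsetSum hterm, List.length_cons,
            Finset.sum_range_succ' _ (L.length + 1), add_comm]
          simp [iterInt]

end Concat

/-- Multiplicativity of the Chen map: for the concatenation `α⋆β` of two piecewise `C¹`
paths in an open set `W ⊆ ℂ²` with `α(1) = β(0)`, and holomorphic 1-forms `ω₁, …, ω_k` on `W`,
`∫_{α⋆β} ω₁⋯ω_k = Σ_{i=0}^{k} (∫_β ω₁⋯ω_i)·(∫_α ω_{i+1}⋯ω_k)`. -/
theorem chen_map_multiplicative
    (W : Set (ℂ × ℂ)) (hW : IsOpen W)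
    (α β : ℝ → ℂ × ℂ) (hα : PiecewiseC1 α) (hβ : PiecewiseC1 β)
    (hαW : ∀ s ∈ Set.Icc (0:ℝ) 1, α s ∈ W) (hβW : ∀ s ∈ Set.Icc (0:ℝ) 1, β s ∈ W)
    (hend : α 1 = β 0)
    (L : List Form1) (hL : ∀ ω ∈ L, HolFormOn W ω) :
    iterInt (concat α β) L 1
      = ∑ i ∈ Finset.range (L.length + 1),
          iterInt β (L.take i) 1 * iterInt α (L.drop i) 1 := by
  have h := iterInt_concat_of_ge hα hβ hαW hβW L hL (s := 1) ⟨by norm_num, le_rfl⟩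
  rwa [show (2 : ℝ) * 1 - 1 = 1 by norm_num] at h
end

section
/- Let W ⊆ ℂ² be open, γ : [0,1] → W a piecewise continuously differentiable path with initial point p₀ = γ(0), g : W → ℂ holomorphic, and ω₁, …, ω_n (n ≥ 1) holomorphic 1-forms on W. Then ∫_γ ω₁ ⋯ ω_n (dg) = ∫_γ ω₁ ⋯ ω_{n−1} (g·ω_n) − g(p₀) · ∫_γ ω₁ ⋯ ω_n. -/
/-- The differential `dg = (∂g/∂x) dx + (∂g/∂y) dy` of a function `g`. -/
noncomputable def dform (g : ℂ × ℂ → ℂ) : Form1 :=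
  (fun p => fderiv ℂ g p (1, 0), fun p => fderiv ℂ g p (0, 1))

/-- The 1-form `g·ω`. -/
def smulForm (g : ℂ × ℂ → ℂ) (ω : Form1) : Form1 :=
  (fun p => g p * ω.1 p, fun p => g p * ω.2 p)

open Set Filter Topology MeasureTheory

/-- The directional derivatives of a holomorphic function are continuous. -/
theorem continuousOn_fderiv_apply_of_differentiableOn {E F : Type*} [NormedAddCommGroup E]
    [NormedSpace ℂ E] [ProperSpace E] [NormedAddCommGroup F] [NormedSpace ℂ F] [CompleteSpace F]
    {W : Set E} (hW : IsOpen W) {g : E → F} (hg : DifferentiableOn ℂ g W) (v : E) :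
    ContinuousOn (fun p => fderiv ℂ g p v) W := by
  intro p₀ hp₀
  apply ContinuousAt.continuousWithinAt
  have hline : Continuous (fun q : E × ℂ => q.1 + q.2 • v) := by fun_prop
  have hmem : (fun q : E × ℂ => q.1 + q.2 • v) ⁻¹' W ∈ 𝓝 (p₀, (0 : ℂ)) :=
    (hW.preimage hline).mem_nhds (by simpa using hp₀)
  obtain ⟨r, hr, hsub⟩ := Metric.nhds_basis_closedBall.mem_iff.1 hmem
  rw [← closedBall_prod_same] at hsub
  have hdiff : ∀ p ∈ Metric.closedBall p₀ r,
      DifferentiableOn ℂ (fun z : ℂ => g (p + z • v)) (Metric.ball 0 r) := fun p hp =>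
    hg.comp (by fun_prop) fun z hz =>
      hsub (a := (p, z)) ⟨hp, Metric.ball_subset_closedBall hz⟩
  have hunif : TendstoUniformlyOn (fun (p : E) (z : ℂ) => g (p + z • v))
      (fun z => g (p₀ + z • v)) (𝓝[Metric.closedBall p₀ r] p₀) (Metric.closedBall 0 r) := by
    refine UniformContinuousOn.tendstoUniformlyOn (F := fun (p : E) (z : ℂ) => g (p + z • v)) ?_
      (Metric.mem_closedBall_self hr.le)
    refine IsCompact.uniformContinuousOn_of_continuous
      ((isCompact_closedBall p₀ r).prod (isCompact_closedBall 0 r)) ?_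
    exact hg.continuousOn.comp hline.continuousOn hsub
  have hball := Metric.closedBall_mem_nhds p₀ hr
  rw [nhdsWithin_eq_nhds.2 hball] at hunif
  have hderiv := ((hunif.mono Metric.ball_subset_closedBall).tendstoLocallyUniformlyOn.deriv
    (by filter_upwards [hball] with p hp using hdiff p hp) Metric.isOpen_ball).tendsto_at
    (Metric.mem_ball_self hr)
  have hchain : ∀ p ∈ W, deriv (fun z : ℂ => g (p + z • v)) 0 = fderiv ℂ g p v := by
    intro p hp
    have hgp : HasFDerivAt g (fderiv ℂ g p) (p + (0 : ℂ) • v) := by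
      simpa using (hg.differentiableAt (hW.mem_nhds hp)).hasFDerivAt
    have hl : HasDerivAt (fun z : ℂ => p + z • v) v 0 := by
      simpa using ((hasDerivAt_id (0 : ℂ)).smul_const v).const_add p
    exact (hgp.comp_hasDerivAt 0 hl).deriv
  rw [ContinuousAt, ← hchain p₀ hp₀]
  refine hderiv.congr' ?_
  filter_upwards [hW.mem_nhds hp₀] with p hp using hchain p hp

/-- A 1-form whose coefficient functions are continuous on `W`. -/
def ContFormOn (W : Set (ℂ × ℂ)) (ω : Form1) : Prop :=
  ContinuousOn ω.1 W ∧ ContinuousOn ω.2 W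

theorem HolFormOn.contFormOn {W : Set (ℂ × ℂ)} {ω : Form1} (h : HolFormOn W ω) :
    ContFormOn W ω :=
  ⟨h.1.continuousOn, h.2.continuousOn⟩

theorem contFormOn_dform {W : Set (ℂ × ℂ)} (hW : IsOpen W) {g : ℂ × ℂ → ℂ}
    (hg : DifferentiableOn ℂ g W) : ContFormOn W (dform g) :=
  ⟨continuousOn_fderiv_apply_of_differentiableOn hW hg _,
    continuousOn_fderiv_apply_of_differentiableOn hW hg _⟩

theorem ContFormOn.smulForm {W : Set (ℂ × ℂ)} {g : ℂ × ℂ → ℂ} {ω : Form1}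
    (hω : ContFormOn W ω) (hg : ContinuousOn g W) : ContFormOn W (smulForm g ω) :=
  ⟨hg.mul hω.1, hg.mul hω.2⟩

theorem pull_smulForm (γ : ℝ → ℂ × ℂ) (g : ℂ × ℂ → ℂ) (ω : Form1) (s : ℝ) :
    pull γ (smulForm g ω) s = g (γ s) * pull γ ω s := by
  simp only [pull, smulForm]
  ring

section Path

variable {W : Set (ℂ × ℂ)} {γ : ℝ → ℂ × ℂ}

theorem intervalIntegrable_pull_of_contDiffOn {a b : ℝ} (hab : a < b)
    (hγ : ContDiffOn ℝ 1 γ (Icc a b)) (hγW : MapsTo γ (Icc a b) W) {ω : Form1}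
    (hω : ContFormOn W ω) : IntervalIntegrable (pull γ ω) volume a b := by
  have hcont : ContinuousOn (fun s =>
      ω.1 (γ s) * derivWithin (fun u => (γ u).1) (Icc a b) s +
        ω.2 (γ s) * derivWithin (fun u => (γ u).2) (Icc a b) s) (uIcc a b) := by
    rw [uIcc_of_le hab.le]
    have hu := uniqueDiffOn_Icc hab
    exact ((hω.1.comp hγ.continuousOn hγW).mul
        (hγ.fst.continuousOn_derivWithin hu le_rfl)).add
      ((hω.2.comp hγ.continuousOn hγW).mul
        (hγ.snd.continuousOn_derivWithin hu le_rfl))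
  refine hcont.intervalIntegrable.congr_uIoo fun s hs => ?_
  rw [uIoo_of_le hab.le] at hs
  have hnhds := Icc_mem_nhds hs.1 hs.2
  simp only [pull, derivWithin_of_mem_nhds hnhds]

theorem PiecewiseC1.intervalIntegrable_pull_s3 (hγ : PiecewiseC1 γ)
    (hγW : MapsTo γ (Icc 0 1) W) {ω : Form1} (hω : ContFormOn W ω) :
    IntervalIntegrable (pull γ ω) volume 0 1 := by
  obtain ⟨-, n, t, ht, ht0, ht1, hC⟩ := hγ
  have key : ∀ i, IntervalIntegrable (pull γ ω) volume 0 (t i) := by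
    intro i
    induction i using Fin.induction with
    | zero => simp [ht0]
    | succ i ih =>
      refine ih.trans (intervalIntegrable_pull_of_contDiffOn (ht i.castSucc_lt_succ) (hC i)
        (hγW.mono_left ?_) hω)
      exact Icc_subset_Icc (ht0 ▸ ht.monotone (Fin.zero_le _)) (ht1 ▸ ht.monotone (Fin.le_last _))
  exact ht1 ▸ key (Fin.last n)

/-- A piecewise `C¹` path is differentiable off the finite set of its break points. -/
theorem PiecewiseC1.exists_finite_differentiableAt (hγ : PiecewiseC1 γ) :
    ∃ S : Set ℝ, S.Finite ∧ ∀ s ∈ Ioo (0 : ℝ) 1 \ S, DifferentiableAt ℝ γ s := by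
  obtain ⟨-, n, t, -, ht0, ht1, hC⟩ := hγ
  refine ⟨range t, finite_range t, fun s hs => ?_⟩
  have key : ∀ i, s < t i → DifferentiableAt ℝ γ s := by
    intro i
    induction i using Fin.induction with
    | zero => intro h; exact absurd hs.1.1 (by rw [ht0] at h; exact h.not_gt)
    | succ i ih =>
      intro h
      rcases lt_trichotomy s (t i.castSucc) with h' | h' | h'
      · exact ih h'
      · exact absurd ⟨_, h'.symm⟩ hs.2
      · exact ((hC i).differentiableOn one_ne_zero).differentiableAt (Icc_mem_nhds h' h)
  exact key (Fin.last n) (ht1 ▸ hs.1.2)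

theorem PiecewiseC1.continuousOn_iterInt_s3 (hγ : PiecewiseC1 γ) (hγW : MapsTo γ (Icc 0 1) W)
    {L : List Form1} (hL : ∀ ω ∈ L, ContFormOn W ω) :
    ContinuousOn (iterInt γ L) (uIcc 0 1) := by
  induction L with
  | nil => exact continuousOn_const
  | cons ω L ih =>
    rw [List.forall_mem_cons] at hL
    exact intervalIntegral.continuousOn_primitive_interval'
      ((hγ.intervalIntegrable_pull_s3 hγW hL.1).mul_continuousOn (ih hL.2)) left_mem_uIcc

theorem PiecewiseC1.intervalIntegrable_pull_mul_iterInt_s3 (hγ : PiecewiseC1 γ)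
    (hγW : MapsTo γ (Icc 0 1) W) {ω : Form1} (hω : ContFormOn W ω) {L : List Form1}
    (hL : ∀ ω ∈ L, ContFormOn W ω) {s : ℝ} (hs : s ∈ Icc (0 : ℝ) 1) :
    IntervalIntegrable (fun u => pull γ ω u * iterInt γ L u) volume 0 s :=
  ((hγ.intervalIntegrable_pull_s3 hγW hω).mul_continuousOn
    (hγ.continuousOn_iterInt_s3 hγW hL)).mono_set
    (uIcc_subset_uIcc_left (by rwa [uIcc_of_le zero_le_one]))

theorem PiecewiseC1.iterInt_dform (hW : IsOpen W) (hγ : PiecewiseC1 γ)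
    (hγW : MapsTo γ (Icc 0 1) W) {g : ℂ × ℂ → ℂ} (hg : DifferentiableOn ℂ g W) {s : ℝ}
    (hs : s ∈ Icc (0 : ℝ) 1) : iterInt γ [dform g] s = g (γ s) - g (γ 0) := by
  obtain ⟨S, hS, hd⟩ := hγ.exists_finite_differentiableAt
  have hint := hγ.intervalIntegrable_pull_mul_iterInt_s3 hγW (contFormOn_dform hW hg)
    (L := []) (by simp) hs
  simp only [iterInt, mul_one] at hint ⊢
  refine integral_eq_of_hasDerivAt_off_countable_of_le (fun u => g (γ u)) _ hs.1 hS.countable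
    ((hg.continuousOn.comp hγ.1 hγW).mono (Icc_subset_Icc_right hs.2)) (fun u hu => ?_) hint
  have hu01 : u ∈ Ioo (0 : ℝ) 1 := ⟨hu.1.1, hu.1.2.trans_le hs.2⟩
  have hγu := (hd u ⟨hu01, hu.2⟩).hasDerivAt
  have hgu := ((hg.differentiableAt
    (hW.mem_nhds (hγW (Ioo_subset_Icc_self hu01)))).hasFDerivAt).restrictScalars ℝ
  have hdecomp : deriv γ u =
      (deriv γ u).1 • ((1, 0) : ℂ × ℂ) + (deriv γ u).2 • ((0, 1) : ℂ × ℂ) := by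
    ext <;> simp
  refine (hgu.comp_hasDerivAt u hγu).congr_deriv ?_
  have hfst : deriv (fun u => (γ u).1) u = (deriv γ u).1 :=
    ((ContinuousLinearMap.fst ℝ ℂ ℂ).hasFDerivAt.comp_hasDerivAt u hγu).deriv
  have hsnd : deriv (fun u => (γ u).2) u = (deriv γ u).2 :=
    ((ContinuousLinearMap.snd ℝ ℂ ℂ).hasFDerivAt.comp_hasDerivAt u hγu).deriv
  simp only [pull, dform, hfst, hsnd, ContinuousLinearMap.coe_restrictScalars']
  conv_lhs => rw [hdecomp, map_add, map_smul, map_smul]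
  simp only [smul_eq_mul]
  ring

theorem PiecewiseC1.iterInt_append_dform (hW : IsOpen W) (hγ : PiecewiseC1 γ)
    (hγW : MapsTo γ (Icc 0 1) W) {g : ℂ × ℂ → ℂ} (hg : DifferentiableOn ℂ g W)
    {A : List Form1} {ω : Form1} (hA : ∀ η ∈ A, ContFormOn W η) (hω : ContFormOn W ω)
    {s : ℝ} (hs : s ∈ Icc (0 : ℝ) 1) :
    iterInt γ (A ++ [ω, dform g]) s
      = iterInt γ (A ++ [smulForm g ω]) s - g (γ 0) * iterInt γ (A ++ [ω]) s := by
  have hgω := hω.smulForm hg.continuousOn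
  have hsub : uIcc 0 s ⊆ Icc 0 1 := by
    rw [uIcc_of_le hs.1]
    exact Icc_subset_Icc_right hs.2
  induction A generalizing s with
  | nil =>
    have h₁ := hγ.intervalIntegrable_pull_mul_iterInt_s3 hγW hgω (L := []) (by simp) hs
    have h₂ := hγ.intervalIntegrable_pull_mul_iterInt_s3 hγW hω (L := []) (by simp) hs
    simp only [List.nil_append]
    rw [iterInt, iterInt, iterInt, ← intervalIntegral.integral_const_mul,
      ← intervalIntegral.integral_sub h₁ (h₂.const_mul _)]
    refine intervalIntegral.integral_congr fun u hu => ?_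
    simp only [hγ.iterInt_dform hW hγW hg (hsub hu), pull_smulForm]
    simp only [iterInt]
    ring
  | cons η A ih =>
    rw [List.forall_mem_cons] at hA
    have h₁ := hγ.intervalIntegrable_pull_mul_iterInt_s3 hγW hA.1 (L := A ++ [smulForm g ω])
      (List.forall_mem_append.2 ⟨hA.2, List.forall_mem_singleton.2 hgω⟩) hs
    have h₂ := hγ.intervalIntegrable_pull_mul_iterInt_s3 hγW hA.1 (L := A ++ [ω])
      (List.forall_mem_append.2 ⟨hA.2, List.forall_mem_singleton.2 hω⟩) hs
    simp only [List.cons_append]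
    rw [iterInt, iterInt, iterInt, ← intervalIntegral.integral_const_mul,
      ← intervalIntegral.integral_sub h₁ (h₂.const_mul _)]
    refine intervalIntegral.integral_congr fun u hu => ?_
    have hu01 := hsub hu
    simp only [ih hA.2 hu01 ((uIcc_of_le hu01.1).trans_subset (Icc_subset_Icc_right hu01.2))]
    ring

end Path

/-- Integrating an exact form `dg` in the last slot of an iterated integral (here
`A = ω₁⋯ω_{n−1}` and `ωn = ω_n`, so the form list `A ++ [ωn]` is `ω₁⋯ω_n`, `n ≥ 1`):
`∫_γ ω₁ ⋯ ω_n (dg) = ∫_γ ω₁ ⋯ ω_{n−1} (g·ω_n) − g(p₀) · ∫_γ ω₁ ⋯ ω_n`,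
where `p₀ = γ(0)` is the initial point. -/
theorem iterated_integral_exact_last
    (W : Set (ℂ × ℂ)) (hW : IsOpen W)
    (γ : ℝ → ℂ × ℂ) (hγ : PiecewiseC1 γ) (hγW : ∀ s ∈ Set.Icc (0:ℝ) 1, γ s ∈ W)
    (g : ℂ × ℂ → ℂ) (hg : DifferentiableOn ℂ g W)
    (A : List Form1) (ωn : Form1)
    (hA : ∀ ω ∈ A, HolFormOn W ω) (hωn : HolFormOn W ωn) :
    iterInt γ (A ++ [ωn, dform g]) 1
      = iterInt γ (A ++ [smulForm g ωn]) 1 - g (γ 0) * iterInt γ (A ++ [ωn]) 1 := by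
  exact hγ.iterInt_append_dform hW hγW hg (fun η hη => (hA η hη).contFormOn) hωn.contFormOn
    ⟨zero_le_one, le_rfl⟩
end

section
/- Let W ⊆ ℂ² be open, R : W → ℂ holomorphic, U ⊆ ℂ open, and Γ : U × [0,1] → W a twice continuously differentiable map such that R(Γ(t,s)) = t for all (t,s) ∈ U × [0,1] and Γ(t,0) = Γ(t,1) for all t ∈ U (a family of cycles δ(t) = Γ(t,·) lying on the level curves {R = t}). Let ω be a holomorphic 1-form on W and let ξ be a Gelfand–Leray derivative of ω with respect to R (i.e. dω = dR ∧ ξ). Then the function t ↦ ∮_{Γ(t,·)} ω (the ordinary line integral of ω along the loop Γ(t,·)) is differentiable on U, and its derivative at every t ∈ U equals ∮_{Γ(t,·)} ξ. -/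
/-- The line integral `∮_γ ω = ∫₀¹ (γ*ω)(s) ds`. -/
noncomputable def lineInt (γ : ℝ → ℂ × ℂ) (ω : Form1) : ℂ :=
  ∫ s in (0:ℝ)..1, pull γ ω s

/-- `ξ = a dx + b dy` is a Gelfand–Leray derivative of `ω = P dx + Q dy` with respect to `R`
on `W`, i.e. `dω = dR ∧ ξ`:  `∂Q/∂x − ∂P/∂y = (∂R/∂x)·b − (∂R/∂y)·a` on `W`. -/
def IsGLDerivOn (W : Set (ℂ × ℂ)) (R : ℂ × ℂ → ℂ) (ω ξ : Form1) : Prop :=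
  ∀ p ∈ W, fderiv ℂ ω.2 p (1, 0) - fderiv ℂ ω.1 p (0, 1)
    = fderiv ℂ R p (1, 0) * ξ.2 p - fderiv ℂ R p (0, 1) * ξ.1 p

open Set Filter Topology MeasureTheory

/-- A holomorphic function on an open subset of a finite-dimensional complex space has a
continuous derivative. -/
theorem continuousOn_fderiv_of_differentiableOn {E F : Type*}
    [NormedAddCommGroup E] [NormedSpace ℂ E] [ProperSpace E]
    [NormedAddCommGroup F] [NormedSpace ℂ F] {W : Set E} (hW : IsOpen W) {f : E → F}
    (hf : DifferentiableOn ℂ f W) : ContinuousOn (fderiv ℂ f) W := by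
  intro p₀ hp₀
  refine ContinuousAt.continuousWithinAt ?_
  obtain ⟨r, hr, hrW⟩ : ∃ r > 0, Metric.closedBall p₀ (r + r) ⊆ W := by
    obtain ⟨r, hr, h⟩ := Metric.nhds_basis_closedBall.mem_iff.1 (hW.mem_nhds hp₀)
    exact ⟨r / 2, by positivity, by simpa using h⟩
  have hunif := (isCompact_closedBall p₀ (r + r)).uniformContinuousOn_of_continuous
    (hf.continuousOn.mono hrW)
  rw [Metric.continuousAt_iff]
  intro ε hε
  obtain ⟨δ, hδ, hclose⟩ := Metric.uniformContinuousOn_iff.1 hunif (r * (ε / 2)) (by positivity)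
  refine ⟨min δ r, by positivity, fun {p} hp => ?_⟩
  obtain ⟨hpδ, hpr⟩ := lt_min_iff.1 hp
  have hmem : ∀ q, dist q p₀ ≤ r → ∀ e : E, ‖e‖ = 1 → ∀ z : ℂ, ‖z‖ ≤ r →
      q + z • e ∈ Metric.closedBall p₀ (r + r) := by
    intro q hq e he z hz
    rw [Metric.mem_closedBall, dist_eq_norm, add_sub_right_comm]
    refine (norm_add_le _ _).trans (add_le_add (by rwa [← dist_eq_norm]) ?_)
    rw [norm_smul, he, mul_one]
    exact hz
  have hline : ∀ q, dist q p₀ ≤ r → ∀ e : E, ‖e‖ = 1 → ∀ z : ℂ, ‖z‖ ≤ r →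
      HasDerivAt (fun z : ℂ => f (q + z • e)) (fderiv ℂ f (q + z • e) e) z := by
    intro q hq e he z hz
    have h := (hf.differentiableAt (hW.mem_nhds (hrW (hmem q hq e he z hz)))).hasFDerivAt
    have h' : HasDerivAt (fun z : ℂ => q + z • e) e z := by
      simpa using ((hasDerivAt_id z).smul_const e).const_add q
    exact h.comp_hasDerivAt z h'
  rw [dist_eq_norm]
  refine (ContinuousLinearMap.opNorm_le_of_unit_norm (C := ε / 2) (by positivity)
    fun e he => ?_).trans_lt (half_lt_self hε)
  have hd : ∀ z : ℂ, ‖z‖ ≤ r → HasDerivAt (fun z : ℂ => f (p + z • e) - f (p₀ + z • e))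
      (fderiv ℂ f (p + z • e) e - fderiv ℂ f (p₀ + z • e) e) z := fun z hz =>
    (hline p hpr.le e he z hz).sub (hline p₀ (by simpa using hr.le) e he z hz)
  have hcauchy := Complex.norm_deriv_le_of_forall_mem_sphere_norm_le (c := 0) (C := r * (ε / 2)) hr
    (f := fun z : ℂ => f (p + z • e) - f (p₀ + z • e))
    (DifferentiableOn.diffContOnCl_ball (U := Metric.closedBall 0 r)
      (fun z hz => (hd z (by simpa using hz)).differentiableAt.differentiableWithinAt) subset_rfl)
    (fun z hz => by
      have hz' : ‖z‖ ≤ r := by simpa using (mem_sphere_zero_iff_norm.1 hz).le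
      rw [← dist_eq_norm]
      refine (hclose _ (hmem p hpr.le e he z hz') _
        (hmem p₀ (by simpa using hr.le) e he z hz') ?_).le
      rwa [dist_add_right])
  rw [(hd 0 (by simpa using hr.le)).deriv] at hcauchy
  simpa [mul_div_assoc, mul_div_cancel_left₀ _ hr.ne'] using hcauchy

theorem contDiffOn_one_of_differentiableOn {E F : Type*}
    [NormedAddCommGroup E] [NormedSpace ℂ E] [ProperSpace E]
    [NormedAddCommGroup F] [NormedSpace ℂ F] {W : Set E} (hW : IsOpen W) {f : E → F}
    (hf : DifferentiableOn ℂ f W) : ContDiffOn ℂ 1 f W := by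
  rw [show (1 : WithTop ℕ∞) = 0 + 1 from rfl, contDiffOn_succ_iff_fderiv_of_isOpen hW]
  exact ⟨hf, by simp, contDiffOn_zero.2 (continuousOn_fderiv_of_differentiableOn hW hf)⟩

theorem clm_apply_eq_coords (L : ℂ × ℂ →L[ℂ] ℂ) (w : ℂ × ℂ) :
    L w = w.1 * L (1, 0) + w.2 * L (0, 1) := by
  rw [← smul_eq_mul, ← smul_eq_mul, ← map_smul, ← map_smul, ← map_add]
  simp

/-- The value at `e` of the pullback to `S` of the 1-form `ω` along the map `F`. -/
noncomputable def pullWithin {E : Type*} [NormedAddCommGroup E] [NormedSpace ℝ E]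
    (F : E → ℂ × ℂ) (S : Set E) (ω : Form1) (e p : E) : ℂ :=
  ω.1 (F p) * (fderivWithin ℝ F S p e).1 + ω.2 (F p) * (fderivWithin ℝ F S p e).2

section pullWithin

variable {E : Type*} [NormedAddCommGroup E] [NormedSpace ℝ E] {F : E → ℂ × ℂ} {S : Set E}
  {W : Set (ℂ × ℂ)} {ω : Form1}

theorem contDiffOn_pullWithin (hW : IsOpen W) (hω : HolFormOn W ω) (hS : UniqueDiffOn ℝ S)
    (hF : ContDiffOn ℝ 2 F S) (hFW : MapsTo F S W) (e : E) :
    ContDiffOn ℝ 1 (pullWithin F S ω e) S := by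
  have hF1 : ContDiffOn ℝ 1 F S := hF.of_le (by norm_num)
  have hP : ContDiffOn ℝ 1 (fun p => ω.1 (F p)) S :=
    ((contDiffOn_one_of_differentiableOn hW hω.1).restrict_scalars ℝ).comp hF1 hFW
  have hQ : ContDiffOn ℝ 1 (fun p => ω.2 (F p)) S :=
    ((contDiffOn_one_of_differentiableOn hW hω.2).restrict_scalars ℝ).comp hF1 hFW
  have hD : ContDiffOn ℝ 1 (fun p => fderivWithin ℝ F S p e) S :=
    (hF.fderivWithin hS (by norm_num)).clm_apply contDiffOn_const
  exact (hP.mul hD.fst).add (hQ.mul hD.snd)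

theorem fderivWithin_pullWithin (hW : IsOpen W) (hω : HolFormOn W ω) (hS : UniqueDiffOn ℝ S)
    (hF : ContDiffOn ℝ 2 F S) (hFW : MapsTo F S W) (e u : E) {p : E} (hp : p ∈ S) :
    fderivWithin ℝ (pullWithin F S ω e) S p u =
      fderiv ℂ ω.1 (F p) (fderivWithin ℝ F S p u) * (fderivWithin ℝ F S p e).1
      + ω.1 (F p) * (fderivWithin ℝ (fderivWithin ℝ F S) S p u e).1
      + (fderiv ℂ ω.2 (F p) (fderivWithin ℝ F S p u) * (fderivWithin ℝ F S p e).2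
      + ω.2 (F p) * (fderivWithin ℝ (fderivWithin ℝ F S) S p u e).2) := by
  have hF' := ((hF.differentiableOn (by norm_num)) p hp).hasFDerivWithinAt
  have hD := (((hF.fderivWithin hS (m := 1) (by norm_num)).differentiableOn
    (by norm_num)) p hp).hasFDerivWithinAt
  have hDe := hD.clm_apply (hasFDerivWithinAt_const e p S)
  have hnhds := hW.mem_nhds (hFW hp)
  have hP := ((hω.1.differentiableAt hnhds).hasFDerivAt.restrictScalars
    ℝ).comp_hasFDerivWithinAt p hF'
  have hQ := ((hω.2.differentiableAt hnhds).hasFDerivAt.restrictScalars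
    ℝ).comp_hasFDerivWithinAt p hF'
  have h : HasFDerivWithinAt (pullWithin F S ω e) _ S p :=
    (hP.mul hDe.fst).add (hQ.mul hDe.snd)
  rw [h.fderivWithin (hS p hp)]
  simp
  ring

/-- The exterior derivative commutes with the pullback. -/
theorem fderivWithin_pullWithin_sub (hW : IsOpen W) (hω : HolFormOn W ω) (hS : UniqueDiffOn ℝ S)
    (hF : ContDiffOn ℝ 2 F S) (hFW : MapsTo F S W) (e u : E) {p : E} (hp : p ∈ S)
    (hp' : p ∈ closure (interior S)) :
    fderivWithin ℝ (pullWithin F S ω e) S p u - fderivWithin ℝ (pullWithin F S ω u) S p e =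
      (fderiv ℂ ω.2 (F p) (1, 0) - fderiv ℂ ω.1 (F p) (0, 1)) *
        ((fderivWithin ℝ F S p u).1 * (fderivWithin ℝ F S p e).2
          - (fderivWithin ℝ F S p u).2 * (fderivWithin ℝ F S p e).1) := by
  have hsymm := (hF p hp).isSymmSndFDerivWithinAt (by simp) hS hp' hp e u
  rw [fderivWithin_pullWithin hW hω hS hF hFW e u hp, fderivWithin_pullWithin hW hω hS hF hFW u e hp,
    hsymm]
  rw [clm_apply_eq_coords (fderiv ℂ ω.1 (F p)) (fderivWithin ℝ F S p u),
    clm_apply_eq_coords (fderiv ℂ ω.1 (F p)) (fderivWithin ℝ F S p e),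
    clm_apply_eq_coords (fderiv ℂ ω.2 (F p)) (fderivWithin ℝ F S p u),
    clm_apply_eq_coords (fderiv ℂ ω.2 (F p)) (fderivWithin ℝ F S p e)]
  ring

end pullWithin

/-- Differentiation under the integral sign for a `C¹` family over a compact interval. -/
theorem hasFDerivAt_integral_of_contDiffOn {H G : Type*} [NormedAddCommGroup H] [NormedSpace ℝ H]
    [ProperSpace H] [NormedAddCommGroup G] [NormedSpace ℝ G] [CompleteSpace G]
    {U : Set H} (hU : IsOpen U) {f : H × ℝ → G} {a b : ℝ} (hab : a < b)
    (hf : ContDiffOn ℝ 1 f (U ×ˢ Icc a b)) {t : H} (ht : t ∈ U) :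
    HasFDerivAt (fun τ => ∫ s in a..b, f (τ, s))
      (∫ s in a..b, (fderivWithin ℝ f (U ×ˢ Icc a b) (t, s)).comp (.inl ℝ H ℝ)) t := by
  have hS : UniqueDiffOn ℝ (U ×ˢ Icc a b) := hU.uniqueDiffOn.prod (uniqueDiffOn_Icc hab)
  have hcont : ContinuousOn
      (fun p => (fderivWithin ℝ f (U ×ˢ Icc a b) p).comp (.inl ℝ H ℝ)) (U ×ˢ Icc a b) :=
    (hf.continuousOn_fderivWithin hS le_rfl).clm_comp continuousOn_const
  obtain ⟨r, hr, hrU⟩ := Metric.nhds_basis_closedBall.mem_iff.1 (hU.mem_nhds ht)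
  obtain ⟨C, hC⟩ := ((isCompact_closedBall t r).prod isCompact_Icc).exists_bound_of_continuousOn
    (hcont.mono (prod_mono hrU (subset_refl (Icc a b))))
  have hpair : ∀ τ ∈ U, MapsTo (fun s : ℝ => (τ, s)) (Icc a b) (U ×ˢ Icc a b) :=
    fun τ hτ s hs => ⟨hτ, hs⟩
  have hslice : ∀ τ ∈ U, ContinuousOn (fun s => f (τ, s)) (Icc a b) :=
    fun τ hτ => hf.continuousOn.comp (by fun_prop) (hpair τ hτ)
  have hΙ : uIoc a b ⊆ Icc a b := by rw [uIoc_of_le hab.le]; exact Ioc_subset_Icc_self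
  refine intervalIntegral.hasFDerivAt_integral_of_dominated_of_fderiv_le (bound := fun _ => C)
    (F := fun τ s => f (τ, s))
    (F' := fun τ s => (fderivWithin ℝ f (U ×ˢ Icc a b) (τ, s)).comp (.inl ℝ H ℝ))
    (Metric.closedBall_mem_nhds t hr) ?_ ?_ ?_ ?_ intervalIntegrable_const ?_
  · filter_upwards [hU.mem_nhds ht] with τ hτ
    exact ((hslice τ hτ).mono hΙ).aestronglyMeasurable measurableSet_uIoc
  · exact (hslice t ht).intervalIntegrable_of_Icc hab.le
  · exact ((hcont.comp (by fun_prop) (hpair t ht)).mono hΙ).aestronglyMeasurable measurableSet_uIoc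
  · exact .of_forall fun s hs τ hτ => hC (τ, s) ⟨hτ, hΙ hs⟩
  · refine .of_forall fun s hs τ hτ => ?_
    have h := (hf.differentiableOn (by norm_num) (τ, s) ⟨hrU hτ, hΙ hs⟩).hasFDerivWithinAt
    have hi : HasFDerivWithinAt (fun σ : H => (σ, s)) (.inl ℝ H ℝ) U τ :=
      (hasFDerivAt_prodMk_left τ s).hasFDerivWithinAt
    have hm : MapsTo (fun σ : H => (σ, s)) U (U ×ˢ Icc a b) := fun σ hσ => ⟨hσ, hΙ hs⟩
    exact (h.comp τ hi hm).hasFDerivAt (hU.mem_nhds (hrU hτ))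

section Family

variable {U : Set ℂ} {Γ : ℂ → ℝ → ℂ × ℂ}

theorem lineInt_eq_integral_pullWithin
    (hΓ : ContDiffOn ℝ 2 (fun p : ℂ × ℝ => Γ p.1 p.2) (U ×ˢ Icc (0:ℝ) 1)) (ω : Form1) {t : ℂ}
    (ht : t ∈ U) :
    lineInt (Γ t) ω = ∫ s in (0:ℝ)..1,
      pullWithin (fun p : ℂ × ℝ => Γ p.1 p.2) (U ×ˢ Icc (0:ℝ) 1) ω (0, 1) (t, s) := by
  refine intervalIntegral.integral_congr_Ioo_of_le zero_le_one fun s hs => ?_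
  have h := (hΓ.differentiableOn (by norm_num) (t, s)
    ⟨ht, Ioo_subset_Icc_self hs⟩).hasFDerivWithinAt
  have hi : HasDerivWithinAt (fun σ : ℝ => (t, σ)) ((0 : ℂ), (1 : ℝ)) (Icc 0 1) s :=
    ((hasDerivAt_const s t).prodMk (hasDerivAt_id s)).hasDerivWithinAt
  have hd := (h.comp_hasDerivWithinAt s hi fun σ hσ => ⟨ht, hσ⟩).hasDerivAt (Icc_mem_nhds hs.1 hs.2)
  have hd1 : deriv (fun σ => (Γ t σ).1) s = _ :=
    ((ContinuousLinearMap.fst ℝ ℂ ℂ).hasFDerivAt.comp_hasDerivAt s hd).deriv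
  have hd2 : deriv (fun σ => (Γ t σ).2) s = _ :=
    ((ContinuousLinearMap.snd ℝ ℂ ℂ).hasFDerivAt.comp_hasDerivAt s hd).deriv
  simp only [pull, pullWithin, hd1, hd2]
  rfl

/-- The `t`-derivative of a family of loops takes the same value at both ends of the loops. -/
theorem fderivWithin_inl_zero_eq_one (hU : IsOpen U)
    (hΓ : ContDiffOn ℝ 2 (fun p : ℂ × ℝ => Γ p.1 p.2) (U ×ˢ Icc (0:ℝ) 1))
    (hloop : ∀ t ∈ U, Γ t 0 = Γ t 1) {t : ℂ} (ht : t ∈ U) (v : ℂ) :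
    fderivWithin ℝ (fun p : ℂ × ℝ => Γ p.1 p.2) (U ×ˢ Icc (0:ℝ) 1) (t, 0) (v, 0) =
      fderivWithin ℝ (fun p : ℂ × ℝ => Γ p.1 p.2) (U ×ˢ Icc (0:ℝ) 1) (t, 1) (v, 0) := by
  have key : ∀ s ∈ Icc (0:ℝ) 1, HasFDerivAt (fun τ => Γ τ s)
      ((fderivWithin ℝ (fun p : ℂ × ℝ => Γ p.1 p.2) (U ×ˢ Icc (0:ℝ) 1) (t, s)).comp
        (.inl ℝ ℂ ℝ)) t := by
    intro s hs
    have h := (hΓ.differentiableOn (by norm_num) (t, s) ⟨ht, hs⟩).hasFDerivWithinAt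
    have hi : HasFDerivWithinAt (fun σ : ℂ => (σ, s)) (.inl ℝ ℂ ℝ) U t :=
      (hasFDerivAt_prodMk_left t s).hasFDerivWithinAt
    have hm : MapsTo (fun σ : ℂ => (σ, s)) U (U ×ˢ Icc (0:ℝ) 1) := fun σ hσ => ⟨hσ, hs⟩
    exact (h.comp t hi hm).hasFDerivAt (hU.mem_nhds ht)
  have h0 := (key 0 (by simp)).congr_of_eventuallyEq
    (f₁ := fun τ => Γ τ 1) (by filter_upwards [hU.mem_nhds ht] with τ hτ using (hloop τ hτ).symm)
  simpa using DFunLike.congr_fun (h0.unique (key 1 (by simp))) v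

end Family

/-- Gelfand–Leray formula: for a `C²` family `Γ : U × [0,1] → W` of cycles
`δ(t) = Γ(t,·)` on the level curves `{R = t}`, and a Gelfand–Leray derivative `ξ` of the
holomorphic 1-form `ω` with respect to `R` (`dω = dR ∧ ξ`), the function `t ↦ ∮_{δ(t)} ω`
is differentiable on `U` with derivative `∮_{δ(t)} ξ`. -/
theorem gelfand_leray_derivative
    (W : Set (ℂ × ℂ)) (hW : IsOpen W) (R : ℂ × ℂ → ℂ) (hR : DifferentiableOn ℂ R W)
    (U : Set ℂ) (hU : IsOpen U)
    (Γ : ℂ → ℝ → ℂ × ℂ)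
    (hΓW : ∀ t ∈ U, ∀ s ∈ Set.Icc (0:ℝ) 1, Γ t s ∈ W)
    (hΓ : ContDiffOn ℝ 2 (fun p : ℂ × ℝ => Γ p.1 p.2) (U ×ˢ Set.Icc (0:ℝ) 1))
    (hlevel : ∀ t ∈ U, ∀ s ∈ Set.Icc (0:ℝ) 1, R (Γ t s) = t)
    (hloop : ∀ t ∈ U, Γ t 0 = Γ t 1)
    (ω ξ : Form1) (hω : HolFormOn W ω) (hξ : HolFormOn W ξ)
    (hGL : IsGLDerivOn W R ω ξ) :
    ∀ t ∈ U, HasDerivAt (fun τ => lineInt (Γ τ) ω) (lineInt (Γ t) ξ) t := by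
  intro t ht
  set S : Set (ℂ × ℝ) := U ×ˢ Icc (0:ℝ) 1 with hS_def
  set F : ℂ × ℝ → ℂ × ℂ := fun p => Γ p.1 p.2 with hF_def
  have hS : UniqueDiffOn ℝ S := hU.uniqueDiffOn.prod (uniqueDiffOn_Icc zero_lt_one)
  have hFW : MapsTo F S W := fun p hp => hΓW p.1 hp.1 p.2 hp.2
  have hSint : S ⊆ closure (interior S) := by
    rw [hS_def, interior_prod_eq, closure_prod_eq, hU.interior_eq, interior_Icc,
      closure_Ioo zero_ne_one]
    exact prod_mono subset_closure subset_rfl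
  have hpair : ∀ s ∈ Icc (0:ℝ) 1, (t, s) ∈ S := fun s hs => ⟨ht, hs⟩
  have hslice : ∀ {g : ℂ × ℝ → ℂ}, ContinuousOn g S → ContinuousOn (fun s => g (t, s)) (Icc 0 1) :=
    fun hg => hg.comp (by fun_prop) hpair
  have hf := contDiffOn_pullWithin hW hω hS hΓ hFW (0, 1)
  have hmain := hasFDerivAt_integral_of_contDiffOn hU zero_lt_one hf ht
  have hRF : ∀ p ∈ S, ∀ u : ℂ × ℝ, fderiv ℂ R (F p) (fderivWithin ℝ F S p u) = u.1 := by
    intro p hp u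
    have hF' := (hΓ.differentiableOn (by norm_num) p hp).hasFDerivWithinAt
    have h := ((hR.differentiableAt (hW.mem_nhds (hFW hp))).hasFDerivAt.restrictScalars
      ℝ).comp_hasFDerivWithinAt p hF'
    have h' : HasFDerivWithinAt (R ∘ F) (.fst ℝ ℂ ℝ) S p :=
      hasFDerivWithinAt_fst.congr (fun q hq => hlevel q.1 hq.1 q.2 hq.2)
        (hlevel p.1 hp.1 p.2 hp.2)
    simpa using DFunLike.congr_fun ((hS p hp).eq h h') u
  have hpoint : ∀ v : ℂ, ∀ s ∈ Icc (0:ℝ) 1,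
      fderivWithin ℝ (pullWithin F S ω (0, 1)) S (t, s) (v, 0) =
        fderivWithin ℝ (pullWithin F S ω (v, 0)) S (t, s) (0, 1)
        + v * pullWithin F S ξ (0, 1) (t, s) := by
    intro v s hs
    have hp := hpair s hs
    have h1 := fderivWithin_pullWithin_sub hW hω hS hΓ hFW (0, 1) (v, 0) hp (hSint hp)
    have hX := hRF _ hp (v, 0)
    have hY := hRF _ hp (0, 1)
    rw [hGL _ (hFW hp)] at h1
    rw [← sub_eq_iff_eq_add', h1, pullWithin]
    rw [clm_apply_eq_coords] at hX hY
    simp only at hX hY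
    linear_combination (ξ.1 (F (t, s)) * (fderivWithin ℝ F S (t, s) (0, 1)).1
      + ξ.2 (F (t, s)) * (fderivWithin ℝ F S (t, s) (0, 1)).2) * hX
      - (ξ.1 (F (t, s)) * (fderivWithin ℝ F S (t, s) (v, 0)).1
      + ξ.2 (F (t, s)) * (fderivWithin ℝ F S (t, s) (v, 0)).2) * hY
  have hexact : ∀ v : ℂ, IntervalIntegrable
      (fun s => fderivWithin ℝ (pullWithin F S ω (v, 0)) S (t, s) (0, 1)) volume 0 1 ∧
      ∫ s in (0:ℝ)..1, fderivWithin ℝ (pullWithin F S ω (v, 0)) S (t, s) (0, 1) = 0 := by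
    intro v
    have hg := contDiffOn_pullWithin hW hω hS hΓ hFW (v, 0)
    have hint : IntervalIntegrable
        (fun s => fderivWithin ℝ (pullWithin F S ω (v, 0)) S (t, s) (0, 1)) volume 0 1 :=
      (hslice ((hg.continuousOn_fderivWithin hS le_rfl).clm_apply
        continuousOn_const)).intervalIntegrable_of_Icc zero_le_one
    refine ⟨hint, ?_⟩
    rw [intervalIntegral.integral_eq_sub_of_hasDerivAt_of_le zero_le_one
      (hslice hg.continuousOn) (fun s hs => ?_) hint]
    · simp only [pullWithin]
      rw [fderivWithin_inl_zero_eq_one hU hΓ hloop ht v]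
      simp only [hF_def, hS_def, hloop t ht, sub_self]
    · have h := (hg.differentiableOn (by norm_num) (t, s)
        (hpair s (Ioo_subset_Icc_self hs))).hasFDerivWithinAt
      have hi : HasDerivWithinAt (fun σ : ℝ => (t, σ)) ((0 : ℂ), (1 : ℝ)) (Icc 0 1) s :=
        ((hasDerivAt_const s t).prodMk (hasDerivAt_id s)).hasDerivWithinAt
      exact (h.comp_hasDerivWithinAt s hi hpair).hasDerivAt (Icc_mem_nhds hs.1 hs.2)
  have hD : ContinuousOn (fun s => (fderivWithin ℝ (pullWithin F S ω (0, 1)) S (t, s)).comp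
      (.inl ℝ ℂ ℝ)) (Icc (0:ℝ) 1) :=
    ((hf.continuousOn_fderivWithin hS le_rfl).clm_comp continuousOn_const).comp
      (by fun_prop) hpair
  have hξint : IntervalIntegrable (fun s => pullWithin F S ξ (0, 1) (t, s)) volume 0 1 :=
    (hslice (contDiffOn_pullWithin hW hξ hS hΓ hFW (0, 1)).continuousOn).intervalIntegrable_of_Icc
      zero_le_one
  rw [hasDerivAt_iff_hasFDerivAt]
  refine hasFDerivAt_of_restrictScalars ℝ (hmain.congr_of_eventuallyEq ?_) ?_
  · filter_upwards [hU.mem_nhds ht] with τ hτ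
    exact lineInt_eq_integral_pullWithin hΓ ω hτ
  · ext1 v
    rw [ContinuousLinearMap.intervalIntegral_apply (hD.intervalIntegrable_of_Icc zero_le_one),
      intervalIntegral.integral_congr (g := fun s =>
        fderivWithin ℝ (pullWithin F S ω (v, 0)) S (t, s) (0, 1)
        + v * pullWithin F S ξ (0, 1) (t, s))
        (fun s hs => by simpa using hpoint v s (by rwa [uIcc_of_le zero_le_one] at hs)),
      intervalIntegral.integral_add (hexact v).1 (hξint.const_mul v), (hexact v).2,
      intervalIntegral.integral_const_mul, lineInt_eq_integral_pullWithin hΓ ξ ht]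
    simp [hF_def, hS_def]
end

section
/- Let W ⊆ ℂ² be open, R : W → ℂ holomorphic, U ⊆ ℂ open, and Γ : U × [0,1] → W a twice continuously differentiable map such that R(Γ(t,s)) = t for all (t,s) ∈ U × [0,1], Γ(t,0) = Γ(t,1) for all t ∈ U, and the base point Γ(t,0) lies on the line {x = 0} for every t ∈ U. For i = 1, …, n let ω_i = P_i dx + Q_i dy be holomorphic 1-forms on W whose pullbacks to the line {x = 0} vanish, i.e. Q_i(0,y) = 0 for every point (0,y) ∈ W. For each i let ξ_i be a Gelfand–Leray derivative of ω_i with respect to R (dω_i = dR ∧ ξ_i), and for each 1 ≤ i ≤ n−1 let ζ_i = a_i dx + b_i dy be a holomorphic 1-form on W with ω_i ∧ ω_{i+1} = dR ∧ ζ_i, i.e. P_i·Q_{i+1} − Q_i·P_{i+1} = (∂R/∂x)·b_i − (∂R/∂y)·a_i on W. Then the function t ↦ ∮_{Γ(t,·)} ω₁ ω₂ ⋯ ω_n is differentiable on U and its derivative at every t ∈ U equals Σ_{i=1}^{n} ∮_{Γ(t,·)} ω₁ ⋯ ω_{i−1} ξ_i ω_{i+1} ⋯ ω_n − Σ_{i=1}^{n−1}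 ∮_{Γ(t,·)} ω₁ ⋯ ω_{i−1} ζ_i ω_{i+2} ⋯ ω_n. -/
open Set MeasureTheory Filter Topology

section ParametricPrimitive

variable {E : Type*} [NormedAddCommGroup E] {U : Set ℂ}

lemma ContinuousOn.slice_Icc {F : Type*} [TopologicalSpace F] {h : ℂ × ℝ → F}
    (hh : ContinuousOn h (U ×ˢ Icc (0:ℝ) 1)) {t : ℂ} (ht : t ∈ U) :
    ContinuousOn (fun u => h (t, u)) (Icc (0:ℝ) 1) :=
  hh.comp (by fun_prop) fun _ hu => ⟨ht, hu⟩

lemma ContinuousOn.intervalIntegrable_slice {h : ℂ × ℝ → E}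
    (hh : ContinuousOn h (U ×ˢ Icc (0:ℝ) 1)) {t : ℂ} (ht : t ∈ U) {s : ℝ}
    (hs : s ∈ Icc (0:ℝ) 1) : IntervalIntegrable (fun u => h (t, u)) volume 0 s := by
  refine ((hh.slice_Icc ht).mono ?_).intervalIntegrable
  rw [uIcc_of_le hs.1]
  exact Icc_subset_Icc_right hs.2

variable [NormedSpace ℝ E]

lemma ContinuousOn.parametric_primitive {h : ℂ × ℝ → E}
    (hh : ContinuousOn h (U ×ˢ Icc (0:ℝ) 1)) :
    ContinuousOn (fun p : ℂ × ℝ => ∫ u in (0:ℝ)..p.2, h (p.1, u)) (U ×ˢ Icc (0:ℝ) 1) := by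
  let g : U → ℝ → E := fun t u => h (t, projIcc (0:ℝ) 1 zero_le_one u)
  have hg : Continuous g.uncurry := by
    refine hh.comp_continuous (f := fun q : U × ℝ =>
      ((q.1 : ℂ), (projIcc (0:ℝ) 1 zero_le_one q.2 : ℝ))) ?_ ?_
    · exact (continuous_subtype_val.comp continuous_fst).prodMk
        (continuous_subtype_val.comp (continuous_projIcc.comp continuous_snd))
    · rintro ⟨t, u⟩
      exact ⟨t.2, (projIcc (0:ℝ) 1 zero_le_one u).2⟩
  have hc := intervalIntegral.continuous_parametric_primitive_of_continuous (μ := volume)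
    (a₀ := (0:ℝ)) hg
  rw [continuousOn_iff_continuous_domRestrict]
  have : (U ×ˢ Icc (0:ℝ) 1).domRestrict (fun p : ℂ × ℝ => ∫ u in (0:ℝ)..p.2, h (p.1, u))
      = (fun p : U × ℝ => ∫ u in (0:ℝ)..p.2, g p.1 u) ∘
        fun q : ↥(U ×ˢ Icc (0:ℝ) 1) => ((⟨q.1.1, q.2.1⟩ : U), q.1.2) := by
    funext q
    simp only [domRestrict_apply, Function.comp_apply]
    refine intervalIntegral.integral_congr fun u hu => ?_
    rw [uIcc_of_le q.2.2.1] at hu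
    simp only [g]
    rw [projIcc_of_mem _ (⟨hu.1, hu.2.trans q.2.2.2⟩ : u ∈ Icc (0:ℝ) 1)]
  rw [this]
  refine hc.comp (Continuous.prodMk ?_ (continuous_snd.comp continuous_subtype_val))
  exact (continuous_fst.comp continuous_subtype_val).subtype_mk _

lemma ContinuousOn.hasDerivAt_primitive [CompleteSpace E] {f : ℝ → E} {a b : ℝ}
    (hf : ContinuousOn f (Icc a b)) {s : ℝ} (hs : s ∈ Ioo a b) :
    HasDerivAt (fun r => ∫ u in a..r, f u) (f s) s := by
  refine intervalIntegral.integral_hasDerivAt_right ?_ ?_ ?_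
  · refine (hf.mono ?_).intervalIntegrable
    rw [uIcc_of_le hs.1.le]
    exact Icc_subset_Icc_right hs.2.le
  · exact (hf.mono Ioo_subset_Icc_self).stronglyMeasurableAtFilter isOpen_Ioo s hs
  · exact hf.continuousAt (Icc_mem_nhds hs.1 hs.2)

lemma hasFDerivAt_parametric_primitive (hU : IsOpen U) {h : ℂ × ℝ → E} {h' : ℂ × ℝ → ℂ →L[ℝ] E}
    (hh : ContinuousOn h (U ×ˢ Icc (0:ℝ) 1)) (hh' : ContinuousOn h' (U ×ˢ Icc (0:ℝ) 1))
    (hd : ∀ p ∈ U ×ˢ Icc (0:ℝ) 1, HasFDerivAt (fun τ => h (τ, p.2)) (h' p) p.1)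
    {t : ℂ} (ht : t ∈ U) {s : ℝ} (hs : s ∈ Icc (0:ℝ) 1) :
    HasFDerivAt (fun τ => ∫ u in (0:ℝ)..s, h (τ, u)) (∫ u in (0:ℝ)..s, h' (t, u)) t := by
  obtain ⟨ε, hε, hball⟩ := Metric.nhds_basis_closedBall.mem_iff.1 (hU.mem_nhds ht)
  have hcpt : IsCompact (Metric.closedBall t ε ×ˢ Icc (0:ℝ) 1) :=
    (isCompact_closedBall t ε).prod isCompact_Icc
  obtain ⟨C, hC⟩ := hcpt.exists_bound_of_continuousOn (hh'.mono (prod_mono_left hball))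
  have hsub : ∀ u ∈ Set.uIoc (0:ℝ) s, u ∈ Icc (0:ℝ) 1 := fun u hu => by
    rw [uIoc_of_le hs.1] at hu
    exact ⟨hu.1.le, hu.2.trans hs.2⟩
  refine intervalIntegral.hasFDerivAt_integral_of_dominated_of_fderiv_le
    (F := fun τ u => h (τ, u)) (F' := fun τ u => h' (τ, u))
    (s := Metric.closedBall t ε) (bound := fun _ => C) (Metric.closedBall_mem_nhds t hε) ?_
    (hh.intervalIntegrable_slice ht hs)
    (intervalIntegrable_iff.1 (hh'.intervalIntegrable_slice ht hs)).aestronglyMeasurable ?_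
    (by simp) ?_
  · filter_upwards [hU.mem_nhds ht] with τ hτ
    exact (intervalIntegrable_iff.1 (hh.intervalIntegrable_slice hτ hs)).aestronglyMeasurable
  · exact Eventually.of_forall fun u hu τ hτ => hC (τ, u) ⟨hτ, hsub u hu⟩
  · exact Eventually.of_forall fun u hu τ hτ => hd (τ, u) ⟨hball hτ, hsub u hu⟩

end ParametricPrimitive

/-- Iterated primitives in the second variable: `iterPrim [a₁, …, a_k] (t, s)` is the iterated
integral over `[0, s]` of the functions `u ↦ aᵢ (t, u)`. -/
noncomputable def iterPrim : List (ℂ × ℝ → ℂ) → ℂ × ℝ → ℂ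
  | [], _ => 1
  | a :: l, p => ∫ u in (0:ℝ)..p.2, a (p.1, u) * iterPrim l (p.1, u)

lemma continuousOn_iterPrim {U : Set ℂ} :
    ∀ l : List (ℂ × ℝ → ℂ), (∀ a ∈ l, ContinuousOn a (U ×ˢ Icc (0:ℝ) 1)) →
      ContinuousOn (iterPrim l) (U ×ˢ Icc (0:ℝ) 1)
  | [], _ => continuousOn_const
  | a :: l, h => by
    have h₁ := h a (by simp)
    have h₂ := continuousOn_iterPrim l fun b hb => h b (by simp [hb])
    exact (h₁.mul h₂).parametric_primitive

/-- `iterPrim` of the list `[A 1, …, A (n - 1)]`, with value `0` for `n = 0`. -/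
noncomputable def tailPrim : ℕ → (ℕ → ℂ × ℝ → ℂ) → ℂ × ℝ → ℂ
  | 0, _, _ => 0
  | n + 1, A, p => iterPrim ((List.range n).map fun i => A (i + 1)) p

/-- The sum of the iterated primitives of `A 0, …, A (n - 1)` with one entry `A i` replaced by
`X i`, minus the sum of those with two consecutive entries `A i, A (i + 1)` replaced by `Z i`. -/
noncomputable def contractSum (n : ℕ) (A X Z : ℕ → ℂ × ℝ → ℂ) (p : ℂ × ℝ) : ℂ :=
  (∑ i ∈ Finset.range n, iterPrim ((List.range n).map (Function.update A i (X i))) p)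
    - ∑ i ∈ Finset.range (n - 1),
        iterPrim (((List.range n).map A).take i ++ Z i :: ((List.range n).map A).drop (i + 2)) p

section Contract

variable {U : Set ℂ} {A X Z : ℕ → ℂ × ℝ → ℂ}

lemma iterPrim_range_succ (n : ℕ) (A : ℕ → ℂ × ℝ → ℂ) (p : ℂ × ℝ) :
    iterPrim ((List.range (n + 1)).map A) p
      = ∫ u in (0:ℝ)..p.2, A 0 (p.1, u)
          * iterPrim ((List.range n).map fun i => A (i + 1)) (p.1, u) := by
  rw [List.range_succ_eq_map, List.map_cons, List.map_map]
  rfl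

lemma continuousOn_iterPrim_range {n : ℕ}
    (hA : ∀ i < n, ContinuousOn (A i) (U ×ˢ Icc (0:ℝ) 1)) :
    ContinuousOn (iterPrim ((List.range n).map A)) (U ×ˢ Icc (0:ℝ) 1) := by
  refine continuousOn_iterPrim _ fun a ha => ?_
  obtain ⟨i, hi, rfl⟩ := List.mem_map.1 ha
  exact hA i (List.mem_range.1 hi)

lemma continuousOn_tailPrim {n : ℕ}
    (hA : ∀ i < n, ContinuousOn (A i) (U ×ˢ Icc (0:ℝ) 1)) :
    ContinuousOn (tailPrim n A) (U ×ˢ Icc (0:ℝ) 1) := by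
  cases n with
  | zero => exact continuousOn_const
  | succ n => exact continuousOn_iterPrim_range fun i hi => hA (i + 1) (by omega)

lemma continuousOn_iterPrim_update {n : ℕ}
    (hA : ∀ i < n, ContinuousOn (A i) (U ×ˢ Icc (0:ℝ) 1))
    (hX : ∀ i < n, ContinuousOn (X i) (U ×ˢ Icc (0:ℝ) 1)) {i : ℕ} (hi : i < n) :
    ContinuousOn (iterPrim ((List.range n).map (Function.update A i (X i))))
      (U ×ˢ Icc (0:ℝ) 1) := by
  refine continuousOn_iterPrim_range fun j hj => ?_
  rcases eq_or_ne j i with rfl | hne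
  · simpa using hX j hj
  · simpa [Function.update_of_ne hne] using hA j hj

lemma continuousOn_iterPrim_contract {n : ℕ}
    (hA : ∀ i < n, ContinuousOn (A i) (U ×ˢ Icc (0:ℝ) 1))
    (hZ : ∀ i < n - 1, ContinuousOn (Z i) (U ×ˢ Icc (0:ℝ) 1)) {i : ℕ} (hi : i < n - 1) :
    ContinuousOn (iterPrim (((List.range n).map A).take i ++
      Z i :: ((List.range n).map A).drop (i + 2))) (U ×ˢ Icc (0:ℝ) 1) := by
  have key : ∀ a ∈ (List.range n).map A, ContinuousOn a (U ×ˢ Icc (0:ℝ) 1) := fun a ha => by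
    obtain ⟨j, hj, rfl⟩ := List.mem_map.1 ha
    exact hA j (List.mem_range.1 hj)
  refine continuousOn_iterPrim _ fun a ha => ?_
  rcases List.mem_append.1 ha with h | h
  · exact key a (List.mem_of_mem_take h)
  · rcases List.mem_cons.1 h with rfl | h
    · exact hZ i hi
    · exact key a (List.mem_of_mem_drop h)

lemma continuousOn_contractSum {n : ℕ}
    (hA : ∀ i < n, ContinuousOn (A i) (U ×ˢ Icc (0:ℝ) 1))
    (hX : ∀ i < n, ContinuousOn (X i) (U ×ˢ Icc (0:ℝ) 1))
    (hZ : ∀ i < n - 1, ContinuousOn (Z i) (U ×ˢ Icc (0:ℝ) 1)) :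
    ContinuousOn (contractSum n A X Z) (U ×ˢ Icc (0:ℝ) 1) :=
  (continuousOn_finsetSum _ fun _ hi =>
    continuousOn_iterPrim_update hA hX (Finset.mem_range.1 hi)).sub
  (continuousOn_finsetSum _ fun _ hi =>
    continuousOn_iterPrim_contract hA hZ (Finset.mem_range.1 hi))

lemma contractSum_succ {n : ℕ}
    (hA : ∀ i < n + 1, ContinuousOn (A i) (U ×ˢ Icc (0:ℝ) 1))
    (hX : ∀ i < n + 1, ContinuousOn (X i) (U ×ˢ Icc (0:ℝ) 1))
    (hZ : ∀ i < n, ContinuousOn (Z i) (U ×ˢ Icc (0:ℝ) 1))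
    {t : ℂ} (ht : t ∈ U) {s : ℝ} (hs : s ∈ Icc (0:ℝ) 1) :
    contractSum (n + 1) A X Z (t, s) = ∫ u in (0:ℝ)..s,
      (X 0 (t, u) * iterPrim ((List.range n).map fun i => A (i + 1)) (t, u)
        + A 0 (t, u) * contractSum n (fun i => A (i + 1)) (fun i => X (i + 1))
            (fun i => Z (i + 1)) (t, u)
        - Z 0 (t, u) * tailPrim n (fun i => A (i + 1)) (t, u)) := by
  have hA' : ∀ i < n, ContinuousOn (A (i + 1)) (U ×ˢ Icc (0:ℝ) 1) :=
    fun i hi => hA (i + 1) (by omega)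
  have hX' : ∀ i < n, ContinuousOn (X (i + 1)) (U ×ˢ Icc (0:ℝ) 1) :=
    fun i hi => hX (i + 1) (by omega)
  have hZ' : ∀ i < n - 1, ContinuousOn (Z (i + 1)) (U ×ˢ Icc (0:ℝ) 1) :=
    fun i hi => hZ (i + 1) (by omega)
  have hA0 := hA 0 (by omega)
  have hX0 := hX 0 (by omega)
  have h₁ : (∑ i ∈ Finset.range (n + 1),
      iterPrim ((List.range (n + 1)).map (Function.update A i (X i))) (t, s))
      = ∫ u in (0:ℝ)..s,
        (X 0 (t, u) * iterPrim ((List.range n).map fun i => A (i + 1)) (t, u)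
        + A 0 (t, u) * ∑ i ∈ Finset.range n, iterPrim ((List.range n).map
            (Function.update (fun i => A (i + 1)) i (X (i + 1)))) (t, u)) := by
    simp_rw [Finset.mul_sum]
    rw [intervalIntegral.integral_add, intervalIntegral.integral_finsetSum,
      Finset.sum_range_succ', add_comm]
    · congr 1
      · rw [iterPrim_range_succ]
        simp
      · refine Finset.sum_congr rfl fun i _ => ?_
        rw [iterPrim_range_succ]
        have : (fun j => Function.update A (i + 1) (X (i + 1)) (j + 1))
            = Function.update (fun j => A (j + 1)) i (X (i + 1)) := by
          funext j
          simp [Function.update_apply]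
        simp [this]
    · intro i hi
      exact (hA0.mul (continuousOn_iterPrim_update (X := fun i => X (i + 1)) hA' hX'
        (Finset.mem_range.1 hi))).intervalIntegrable_slice ht hs
    · exact (hX0.mul (continuousOn_iterPrim_range hA')).intervalIntegrable_slice ht hs
    · exact (continuousOn_finsetSum _ fun i hi => hA0.mul
        (continuousOn_iterPrim_update (X := fun i => X (i + 1)) hA' hX'
          (Finset.mem_range.1 hi))).intervalIntegrable_slice ht hs
  have h₂ : (∑ i ∈ Finset.range n, iterPrim (((List.range (n + 1)).map A).take i ++
        Z i :: ((List.range (n + 1)).map A).drop (i + 2)) (t, s))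
      = ∫ u in (0:ℝ)..s,
        (A 0 (t, u) * (∑ i ∈ Finset.range (n - 1),
            iterPrim (((List.range n).map fun i => A (i + 1)).take i ++
              Z (i + 1) :: ((List.range n).map fun i => A (i + 1)).drop (i + 2)) (t, u))
        + Z 0 (t, u) * tailPrim n (fun i => A (i + 1)) (t, u)) := by
    cases n with
    | zero => simp [tailPrim]
    | succ m =>
      simp_rw [Finset.mul_sum, Nat.add_sub_cancel]
      have hl : (List.range (m + 1 + 1)).map A
          = A 0 :: (List.range (m + 1)).map fun i => A (i + 1) := by
        rw [List.range_succ_eq_map, List.map_cons, List.map_map]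
        rfl
      have hl' : ((List.range (m + 1)).map fun i => A (i + 1))
          = A 1 :: (List.range m).map fun i => A (i + 1 + 1) := by
        rw [List.range_succ_eq_map, List.map_cons, List.map_map]
        rfl
      rw [intervalIntegral.integral_add, intervalIntegral.integral_finsetSum,
        Finset.sum_range_succ']
      · congr 1
        · refine Finset.sum_congr rfl fun i _ => ?_
          rw [hl]
          rfl
        · rw [hl, hl']
          rfl
      · intro i hi
        exact (hA0.mul (continuousOn_iterPrim_contract (Z := fun i => Z (i + 1)) hA' hZ'
          (Finset.mem_range.1 hi))).intervalIntegrable_slice ht hs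
      · exact (continuousOn_finsetSum _ fun i hi => hA0.mul
          (continuousOn_iterPrim_contract (Z := fun i => Z (i + 1)) hA' hZ'
            (Finset.mem_range.1 hi))).intervalIntegrable_slice ht hs
      · exact ((hZ 0 (by omega)).mul (continuousOn_tailPrim hA')).intervalIntegrable_slice ht hs
  have hZ0 : ContinuousOn (fun p => Z 0 p * tailPrim n (fun i => A (i + 1)) p)
      (U ×ˢ Icc (0:ℝ) 1) := by
    cases n with
    | zero => simpa [tailPrim] using continuousOn_const
    | succ m => exact (hZ 0 (by omega)).mul (continuousOn_tailPrim hA')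
  rw [contractSum, Nat.add_sub_cancel, h₁, h₂, ← intervalIntegral.integral_sub]
  · refine intervalIntegral.integral_congr fun u _ => ?_
    simp only [contractSum]
    ring
  · exact ((hX0.mul (continuousOn_iterPrim_range hA')).add (hA0.mul
      (continuousOn_finsetSum _ fun i hi =>
        continuousOn_iterPrim_update (X := fun i => X (i + 1)) hA' hX'
          (Finset.mem_range.1 hi)))).intervalIntegrable_slice ht hs
  · exact ((hA0.mul (continuousOn_finsetSum _ fun i hi =>
      continuousOn_iterPrim_contract (Z := fun i => Z (i + 1)) hA' hZ'
        (Finset.mem_range.1 hi))).add hZ0).intervalIntegrable_slice ht hs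

end Contract

section Variation

variable {U : Set ℂ}

lemma HasFDerivWithinAt.hasFDerivAt_fst_slice {F : Type*} [NormedAddCommGroup F]
    [NormedSpace ℝ F] (hU : IsOpen U) {f : ℂ × ℝ → F} {f' : ℂ × ℝ →L[ℝ] F} {p : ℂ × ℝ}
    (hp : p ∈ U ×ˢ Icc (0:ℝ) 1) (hf : HasFDerivWithinAt f f' (U ×ˢ Icc (0:ℝ) 1) p) :
    HasFDerivAt (fun τ => f (τ, p.2)) (f'.comp (ContinuousLinearMap.inl ℝ ℂ ℝ)) p.1 := by
  have h := hf.comp p.1 (f := fun τ : ℂ => (τ, p.2)) (s := U)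
    (hasFDerivAt_prodMk_left p.1 p.2).hasFDerivWithinAt fun τ hτ => ⟨hτ, hp.2⟩
  exact h.hasFDerivAt (hU.mem_nhds hp.1)

lemma HasFDerivWithinAt.hasDerivAt_snd_slice {F : Type*} [NormedAddCommGroup F]
    [NormedSpace ℝ F] {f : ℂ × ℝ → F} {f' : ℂ × ℝ →L[ℝ] F} {t : ℂ} {s : ℝ}
    (ht : t ∈ U) (hs : s ∈ Ioo (0:ℝ) 1)
    (hf : HasFDerivWithinAt f f' (U ×ˢ Icc (0:ℝ) 1) (t, s)) :
    HasDerivAt (fun u => f (t, u)) (f' (0, 1)) s := by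
  have h := hf.comp s (f := fun u : ℝ => (t, u)) (s := Icc (0:ℝ) 1)
    (hasFDerivAt_prodMk_right t s).hasFDerivWithinAt fun u hu => ⟨ht, hu⟩
  simpa [Function.comp_def] using (h.hasFDerivAt (Icc_mem_nhds hs.1 hs.2)).hasDerivAt

lemma hasDerivAt_iterPrim_range {n : ℕ} {A : ℕ → ℂ × ℝ → ℂ}
    (hA : ∀ i < n, ContinuousOn (A i) (U ×ˢ Icc (0:ℝ) 1)) {t : ℂ} (ht : t ∈ U) {s : ℝ}
    (hs : s ∈ Ioo (0:ℝ) 1) :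
    HasDerivAt (fun u => iterPrim ((List.range n).map A) (t, u))
      (A 0 (t, s) * tailPrim n A (t, s)) s := by
  cases n with
  | zero => simpa [tailPrim, iterPrim] using hasDerivAt_const s (1 : ℂ)
  | succ n =>
    simp_rw [iterPrim_range_succ]
    exact (((hA 0 (by omega)).mul (continuousOn_iterPrim_range fun i hi =>
      hA (i + 1) (by omega))).slice_Icc ht).hasDerivAt_primitive hs

/-- First variation of iterated primitives of the `ds`-components of the one-forms `θ i` on
`ℂ × ℝ`, when `dθ i = dt ∧ X i ds` and `θ i ∧ θ (i + 1) = dt ∧ Z i ds`. -/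
theorem hasFDerivAt_iterPrim (hU : IsOpen U) (n : ℕ) :
    ∀ (θ : ℕ → ℂ × ℝ → (ℂ × ℝ →L[ℝ] ℂ)) (θ' : ℕ → ℂ × ℝ → (ℂ × ℝ →L[ℝ] ℂ × ℝ →L[ℝ] ℂ))
      (X Z : ℕ → ℂ × ℝ → ℂ)
      (_ : ∀ i < n, ∀ p ∈ U ×ˢ Icc (0:ℝ) 1,
        HasFDerivWithinAt (θ i) (θ' i p) (U ×ˢ Icc (0:ℝ) 1) p)
      (_ : ∀ i < n, ContinuousOn (θ' i) (U ×ˢ Icc (0:ℝ) 1))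
      (_ : ∀ i < n, ContinuousOn (X i) (U ×ˢ Icc (0:ℝ) 1))
      (_ : ∀ i < n - 1, ContinuousOn (Z i) (U ×ˢ Icc (0:ℝ) 1))
      (_ : ∀ i < n, ∀ t ∈ U, ∀ v : ℂ, θ i (t, 0) (v, 0) = 0)
      (_ : ∀ i < n, ∀ p ∈ U ×ˢ Icc (0:ℝ) 1, ∀ v : ℂ,
        θ' i p (v, 0) (0, 1) - θ' i p (0, 1) (v, 0) = v * X i p)
      (_ : ∀ i < n - 1, ∀ p ∈ U ×ˢ Icc (0:ℝ) 1, ∀ v : ℂ,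
        θ i p (v, 0) * θ (i + 1) p (0, 1) - θ i p (0, 1) * θ (i + 1) p (v, 0) = v * Z i p),
      ∀ p ∈ U ×ˢ Icc (0:ℝ) 1,
        HasFDerivAt (fun τ => iterPrim ((List.range n).map fun i q => θ i q (0, 1)) (τ, p.2))
          (tailPrim n (fun i q => θ i q (0, 1)) p • (θ 0 p).comp (ContinuousLinearMap.inl ℝ ℂ ℝ)
            + contractSum n (fun i q => θ i q (0, 1)) X Z p • ContinuousLinearMap.id ℝ ℂ) p.1 := by
  induction n with
  | zero =>
    intro θ θ' X Z _ _ _ _ _ _ _ p _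
    refine (hasFDerivAt_const (𝕜 := ℝ) (1 : ℂ) p.1).congr_fderiv ?_
    ext v
    simp [tailPrim, contractSum]
  | succ n ih =>
    intro θ θ' X Z hθ hθ' hX hZ hbase hd hw
    have hθc : ∀ i < n + 1, ContinuousOn (θ i) (U ×ˢ Icc (0:ℝ) 1) :=
      fun i hi p hp => (hθ i hi p hp).continuousWithinAt
    have hA : ∀ i < n + 1, ContinuousOn (fun q => θ i q (0, 1)) (U ×ˢ Icc (0:ℝ) 1) :=
      fun i hi => (hθc i hi).clm_apply continuousOn_const
    have hA' : ∀ i < n, ContinuousOn (fun q => θ (i + 1) q (0, 1)) (U ×ˢ Icc (0:ℝ) 1) :=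
      fun i hi => hA (i + 1) (by omega)
    have hX' : ∀ i < n, ContinuousOn (X (i + 1)) (U ×ˢ Icc (0:ℝ) 1) :=
      fun i hi => hX (i + 1) (by omega)
    have hZ' : ∀ i < n - 1, ContinuousOn (Z (i + 1)) (U ×ˢ Icc (0:ℝ) 1) :=
      fun i hi => hZ (i + 1) (by omega)
    have ih' := ih (fun i => θ (i + 1)) (fun i => θ' (i + 1)) (fun i => X (i + 1))
      (fun i => Z (i + 1)) (fun i hi => hθ (i + 1) (by omega)) (fun i hi => hθ' (i + 1) (by omega))
      hX' hZ' (fun i hi => hbase (i + 1) (by omega)) (fun i hi => hd (i + 1) (by omega))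
      (fun i hi => hw (i + 1) (by omega))
    set A : ℕ → ℂ × ℝ → ℂ := fun i q => θ i q (0, 1) with hAdef
    set J : ℂ × ℝ → ℂ := iterPrim ((List.range n).map fun i => A (i + 1)) with hJ
    set T : ℂ × ℝ → ℂ := tailPrim n (fun i => A (i + 1)) with hT
    set K : ℂ × ℝ → ℂ := contractSum n (fun i => A (i + 1)) (fun i => X (i + 1))
      (fun i => Z (i + 1)) with hK
    have hJc : ContinuousOn J (U ×ˢ Icc (0:ℝ) 1) := continuousOn_iterPrim_range hA'
    have hTc : ContinuousOn T (U ×ˢ Icc (0:ℝ) 1) := continuousOn_tailPrim hA'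
    have hKc : ContinuousOn K (U ×ˢ Icc (0:ℝ) 1) := continuousOn_contractSum hA' hX' hZ'
    let ι := ContinuousLinearMap.inl ℝ ℂ ℝ
    let B : ℂ × ℝ → ℂ →L[ℝ] ℂ := fun q => ((θ' 0 q).flip (0, 1)).comp ι
    let L : ℂ × ℝ → ℂ →L[ℝ] ℂ := fun q =>
      T q • (θ 1 q).comp ι + K q • ContinuousLinearMap.id ℝ ℂ
    have hBc : ContinuousOn B (U ×ˢ Icc (0:ℝ) 1) := by
      have h0 := hθ' 0 (by omega)
      have : ContinuousOn (fun q => (θ' 0 q).flip (0, 1)) (U ×ˢ Icc (0:ℝ) 1) :=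
        ((ContinuousLinearMap.flipₗᵢ ℝ (ℂ × ℝ) (ℂ × ℝ) ℂ).continuous.comp_continuousOn
          h0).clm_apply continuousOn_const
      exact this.clm_comp continuousOn_const
    have hLc : ContinuousOn L (U ×ˢ Icc (0:ℝ) 1) := by
      refine ContinuousOn.add ?_ (hKc.smul continuousOn_const)
      cases n with
      | zero =>
        refine (continuousOn_const (c := (0 : ℂ →L[ℝ] ℂ))).congr fun q _ => ?_
        ext v
        simp [hT, tailPrim]
      | succ m => exact hTc.smul ((hθc 1 (by omega)).clm_comp continuousOn_const)
    have hder : ∀ p ∈ U ×ˢ Icc (0:ℝ) 1,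
        HasFDerivAt (fun τ => A 0 (τ, p.2) * J (τ, p.2)) (A 0 p • L p + J p • B p) p.1 := by
      intro p hp
      have h0 : HasFDerivAt (fun τ => A 0 (τ, p.2)) (B p) p.1 := by
        have h := (hθ 0 (by omega) p hp).clm_apply 
          (hasFDerivWithinAt_const (𝕜 := ℝ) ((0:ℂ), (1:ℝ)) p _)
        have h2 := h.hasFDerivAt_fst_slice hU hp
        refine h2.congr_fderiv ?_
        ext v
        simp [B, ι]
      exact h0.mul (ih' p hp)
    rintro ⟨t, s⟩ ⟨ht, hs⟩
    have hJ0 := hA 0 (by omega)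
    have hmain := hasFDerivAt_parametric_primitive hU (hJ0.mul hJc)
      ((hJ0.smul hLc).add (hJc.smul hBc)) hder ht hs
    simp_rw [iterPrim_range_succ]
    refine hmain.congr_fderiv ?_
    set G : ℝ → ℂ →L[ℝ] ℂ := fun u => J (t, u) • (θ 0 (t, u)).comp ι with hG
    set G' : ℝ → ℂ →L[ℝ] ℂ := fun u => J (t, u) • (θ' 0 (t, u) (0, 1)).comp ι
      + (A 1 (t, u) * T (t, u)) • (θ 0 (t, u)).comp ι with hG'
    set g : ℝ → ℂ := fun u => X 0 (t, u) * J (t, u) + A 0 (t, u) * K (t, u)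
      - Z 0 (t, u) * T (t, u) with hg
    have hTA : ContinuousOn (fun q => A 1 q * T q) (U ×ˢ Icc (0:ℝ) 1) := by
      cases n with
      | zero => simpa [hT, tailPrim] using continuousOn_const
      | succ m => exact (hA 1 (by omega)).mul hTc
    have hTZ : ContinuousOn (fun q => Z 0 q * T q) (U ×ˢ Icc (0:ℝ) 1) := by
      cases n with
      | zero => simpa [hT, tailPrim] using continuousOn_const
      | succ m => exact (hZ 0 (by omega)).mul hTc
    have hG'i : IntervalIntegrable G' volume 0 s := by
      have : ContinuousOn (fun q => J q • (θ' 0 q (0, 1)).comp ι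
          + (A 1 q * T q) • (θ 0 q).comp ι) (U ×ˢ Icc (0:ℝ) 1) :=
        (hJc.smul (((hθ' 0 (by omega)).clm_apply continuousOn_const).clm_comp
          continuousOn_const)).add
        (hTA.smul ((hθc 0 (by omega)).clm_comp continuousOn_const))
      exact this.intervalIntegrable_slice ht hs
    have hgi : IntervalIntegrable g volume 0 s :=
      ((((hX 0 (by omega)).mul hJc).add (hJ0.mul hKc)).sub hTZ).intervalIntegrable_slice ht hs
    have hgi' : IntervalIntegrable (fun u => g u • ContinuousLinearMap.id ℝ ℂ) volume 0 s :=
      ⟨hgi.1.smul_const _, hgi.2.smul_const _⟩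
    have hsplit : ∀ u ∈ Set.uIcc (0:ℝ) s, A 0 (t, u) • L (t, u) + J (t, u) • B (t, u)
        = G' u + g u • ContinuousLinearMap.id ℝ ℂ := by
      intro u hu
      rw [uIcc_of_le hs.1] at hu
      have hp : (t, u) ∈ U ×ˢ Icc (0:ℝ) 1 := ⟨ht, hu.1, hu.2.trans hs.2⟩
      ext v
      have h1 := hd 0 (by omega) (t, u) hp v
      have h2 : (θ 0 (t, u) (v, 0) * A 1 (t, u) - A 0 (t, u) * θ 1 (t, u) (v, 0)) * T (t, u)
          = v * Z 0 (t, u) * T (t, u) := by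
        cases n with
        | zero => simp [hT, tailPrim]
        | succ m => rw [← hw 0 (by omega) (t, u) hp v]
      simp only [L, B, G', g, ι, add_apply, smul_apply,
        ContinuousLinearMap.comp_apply, ContinuousLinearMap.inl_apply,
        ContinuousLinearMap.flip_apply, smul_eq_mul, ContinuousLinearMap.id_apply]
      linear_combination J (t, u) * h1 - h2
    have hFTC : ∫ u in (0:ℝ)..s, G' u = G s - G 0 := by
      refine intervalIntegral.integral_eq_sub_of_hasDerivAt_of_le hs.1 ?_ ?_ hG'i
      · have : ContinuousOn (fun q => J q • (θ 0 q).comp ι) (U ×ˢ Icc (0:ℝ) 1) :=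
          hJc.smul ((hθc 0 (by omega)).clm_comp continuousOn_const)
        exact (this.slice_Icc ht).mono (Icc_subset_Icc_right hs.2)
      · intro u hu
        have hu' : u ∈ Ioo (0:ℝ) 1 := ⟨hu.1, hu.2.trans_le hs.2⟩
        have h1 : HasDerivAt (fun r => (θ 0 (t, r)).comp ι) ((θ' 0 (t, u) (0, 1)).comp ι) u := by
          have h := (hθ 0 (by omega) (t, u) ⟨ht, Ioo_subset_Icc_self hu'⟩).hasDerivAt_snd_slice
            ht hu'
          simpa using h.clm_comp (hasDerivAt_const u ι)
        exact (hasDerivAt_iterPrim_range hA' ht hu').smul h1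
    have hG0 : G 0 = 0 := by
      ext v
      simp [hG, ι, hbase 0 (by omega) t ht v]
    rw [contractSum_succ hA hX hZ ht hs]
    calc ∫ u in (0:ℝ)..s, (A 0 (t, u) • L (t, u) + J (t, u) • B (t, u))
        = ∫ u in (0:ℝ)..s, (G' u + g u • ContinuousLinearMap.id ℝ ℂ) :=
          intervalIntegral.integral_congr hsplit
      _ = G s + (∫ u in (0:ℝ)..s, g u) • ContinuousLinearMap.id ℝ ℂ := by
          rw [intervalIntegral.integral_add hG'i hgi', hFTC, hG0, sub_zero,
            intervalIntegral.integral_smul_const]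

end Variation

section Holomorphic

lemma DifferentiableOn.continuousOn_fderiv_of_isOpen {E : Type*} [NormedAddCommGroup E]
    [NormedSpace ℂ E] [ProperSpace E] {W : Set E} (hW : IsOpen W) {f : E → ℂ}
    (hf : DifferentiableOn ℂ f W) : ContinuousOn (fderiv ℂ f) W := by
  intro p₀ hp₀
  obtain ⟨r, hr, hball⟩ := Metric.nhds_basis_closedBall.mem_iff.1 (hW.mem_nhds hp₀)
  have huc : UniformContinuousOn f (Metric.closedBall p₀ r) :=
    (isCompact_closedBall p₀ r).uniformContinuousOn_of_continuous
      (hf.continuousOn.mono hball)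
  refine ContinuousAt.continuousWithinAt (Metric.continuousAt_iff.2 fun ε hε => ?_)
  obtain ⟨δ, hδ, hδf⟩ := Metric.uniformContinuousOn_iff.1 huc (ε / 2 * (r / 2)) (by positivity)
  refine ⟨min δ (r / 2), by positivity, fun {p} hp => ?_⟩
  have hpδ : Dist.dist p p₀ < δ := hp.trans_le (min_le_left _ _)
  have hpr : Dist.dist p p₀ < r / 2 := hp.trans_le (min_le_right _ _)
  rw [dist_eq_norm]
  refine lt_of_le_of_lt (ContinuousLinearMap.opNorm_le_of_unit_norm (half_pos hε).le
    fun v hv => ?_) (half_lt_self hε)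
  have hmem : ∀ z ∈ Metric.closedBall (0:ℂ) (r / 2), ∀ q : E, Dist.dist q p₀ < r / 2 →
      q + z • v ∈ Metric.closedBall p₀ r := by
    intro z hz q hq
    rw [mem_closedBall_zero_iff] at hz
    rw [dist_eq_norm] at hq
    rw [mem_closedBall_iff_norm, add_sub_right_comm]
    refine (norm_add_le _ _).trans ?_
    rw [norm_smul, hv]
    linarith
  have hp₀r : Dist.dist p₀ p₀ < r / 2 := by simpa using half_pos hr
  have hder : ∀ q : E, Dist.dist q p₀ < r / 2 → ∀ z ∈ Metric.closedBall (0:ℂ) (r / 2),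
      HasDerivAt (fun z : ℂ => f (q + z • v)) (fderiv ℂ f (q + z • v) v) z := by
    intro q hq z hz
    have h1 : HasFDerivAt f (fderiv ℂ f (q + z • v)) (q + z • v) :=
      (hf.differentiableAt (hW.mem_nhds (hball (hmem z hz q hq)))).hasFDerivAt
    have h2 : HasDerivAt (fun z : ℂ => q + z • v) v z := by
      simpa using ((hasDerivAt_id z).smul_const v).const_add q
    exact h1.comp_hasDerivAt z h2
  have hsub : ∀ z ∈ Metric.closedBall (0:ℂ) (r / 2),
      HasDerivAt (fun z : ℂ => f (p + z • v) - f (p₀ + z • v))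
        (fderiv ℂ f (p + z • v) v - fderiv ℂ f (p₀ + z • v) v) z := fun z hz =>
    (hder p hpr z hz).sub (hder p₀ hp₀r z hz)
  have h0 := (hsub 0 (Metric.mem_closedBall_self (by positivity))).deriv
  simp only [zero_smul, add_zero] at h0
  rw [sub_apply, ← h0]
  have := Complex.norm_deriv_le_of_forall_mem_sphere_norm_le (c := (0:ℂ)) (R := r / 2)
    (C := ε / 2 * (r / 2)) (f := fun z : ℂ => f (p + z • v) - f (p₀ + z • v)) (half_pos hr)
    (DifferentiableOn.diffContOnCl (by
      rw [closure_ball _ (half_pos hr).ne']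
      exact fun z hz => (hsub z hz).differentiableAt.differentiableWithinAt)) (fun z hz => by
      have hz' := Metric.sphere_subset_closedBall hz
      rw [← dist_eq_norm]
      refine (hδf _ (hmem z hz' p hpr) _ (hmem z hz' p₀ hp₀r) ?_).le
      rwa [dist_add_right])
  rwa [mul_div_cancel_right₀ _ (half_pos hr).ne'] at this

lemma DifferentiableOn.contDiffOn_one_of_isOpen {E : Type*} [NormedAddCommGroup E]
    [NormedSpace ℂ E] [ProperSpace E] {W : Set E} (hW : IsOpen W) {f : E → ℂ}
    (hf : DifferentiableOn ℂ f W) : ContDiffOn ℂ 1 f W := by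
  rw [← zero_add (1 : WithTop ℕ∞), contDiffOn_succ_iff_fderiv_of_isOpen hW]
  exact ⟨hf, by simp, contDiffOn_zero.2 (hf.continuousOn_fderiv_of_isOpen hW)⟩

end Holomorphic

/-- The pullback of the 1-form `ω` along a map `G : ℂ × ℝ → ℂ × ℂ` with derivative `D`. -/
noncomputable def pullForm (G : ℂ × ℝ → ℂ × ℂ) (D : ℂ × ℝ → (ℂ × ℝ →L[ℝ] ℂ × ℂ)) (ω : Form1)
    (q : ℂ × ℝ) : ℂ × ℝ →L[ℝ] ℂ :=
  ω.1 (G q) • (ContinuousLinearMap.fst ℝ ℂ ℂ).comp (D q)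
    + ω.2 (G q) • (ContinuousLinearMap.snd ℝ ℂ ℂ).comp (D q)

lemma pullForm_apply (G : ℂ × ℝ → ℂ × ℂ) (D : ℂ × ℝ → (ℂ × ℝ →L[ℝ] ℂ × ℂ)) (ω : Form1)
    (q w : ℂ × ℝ) :
    pullForm G D ω q w = ω.1 (G q) * (D q w).1 + ω.2 (G q) * (D q w).2 := rfl

lemma ContinuousLinearMap.apply_prod_complex (L : ℂ × ℂ →L[ℂ] ℂ) (v : ℂ × ℂ) :
    L v = L (1, 0) * v.1 + L (0, 1) * v.2 := by
  conv_lhs => rw [show v = v.1 • ((1:ℂ), (0:ℂ)) + v.2 • ((0:ℂ), (1:ℂ)) by ext <;> simp]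
  rw [map_add, map_smul, map_smul, smul_eq_mul, smul_eq_mul, mul_comm, mul_comm v.2]

section Pullback

variable {W : Set (ℂ × ℂ)} {U : Set ℂ} {G : ℂ × ℝ → ℂ × ℂ}

lemma uniqueDiffOn_prod_Icc (hU : IsOpen U) : UniqueDiffOn ℝ (U ×ˢ Icc (0:ℝ) 1) :=
  hU.uniqueDiffOn.prod (uniqueDiffOn_Icc zero_lt_one)

lemma contDiffOn_pullForm (hW : IsOpen W) (hU : IsOpen U)
    (hGW : MapsTo G (U ×ˢ Icc (0:ℝ) 1) W) (hG : ContDiffOn ℝ 2 G (U ×ˢ Icc (0:ℝ) 1))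
    {ω : Form1} (hω : HolFormOn W ω) :
    ContDiffOn ℝ 1 (pullForm G (fderivWithin ℝ G (U ×ˢ Icc (0:ℝ) 1)) ω)
      (U ×ˢ Icc (0:ℝ) 1) := by
  have hD : ContDiffOn ℝ 1 (fderivWithin ℝ G (U ×ˢ Icc (0:ℝ) 1)) (U ×ˢ Icc (0:ℝ) 1) :=
    hG.fderivWithin (uniqueDiffOn_prod_Icc hU) (by norm_num)
  have hG1 : ContDiffOn ℝ 1 G (U ×ˢ Icc (0:ℝ) 1) := hG.of_le (by norm_num)
  have h1 := ((hω.1.contDiffOn_one_of_isOpen hW).restrict_scalars ℝ).comp hG1 hGW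
  have h2 := ((hω.2.contDiffOn_one_of_isOpen hW).restrict_scalars ℝ).comp hG1 hGW
  exact (h1.smul (contDiffOn_const.clm_comp hD)).add (h2.smul (contDiffOn_const.clm_comp hD))

lemma continuousOn_pullForm_apply (hU : IsOpen U)
    (hGW : MapsTo G (U ×ˢ Icc (0:ℝ) 1) W) (hG : ContDiffOn ℝ 2 G (U ×ˢ Icc (0:ℝ) 1))
    {ω : Form1} (hω : HolFormOn W ω) (w : ℂ × ℝ) :
    ContinuousOn (fun q => pullForm G (fderivWithin ℝ G (U ×ˢ Icc (0:ℝ) 1)) ω q w)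
      (U ×ˢ Icc (0:ℝ) 1) := by
  have hD : ContinuousOn (fun q => fderivWithin ℝ G (U ×ˢ Icc (0:ℝ) 1) q w)
      (U ×ˢ Icc (0:ℝ) 1) :=
    (hG.continuousOn_fderivWithin (uniqueDiffOn_prod_Icc hU) (by norm_num)).clm_apply
      continuousOn_const
  exact ((hω.1.continuousOn.comp hG.continuousOn hGW).mul hD.fst).add
    ((hω.2.continuousOn.comp hG.continuousOn hGW).mul hD.snd)

lemma fderiv_level_apply (hW : IsOpen W) (hU : IsOpen U) {R : ℂ × ℂ → ℂ}
    (hR : DifferentiableOn ℂ R W)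
    (hGW : MapsTo G (U ×ˢ Icc (0:ℝ) 1) W) (hG : ContDiffOn ℝ 2 G (U ×ˢ Icc (0:ℝ) 1))
    (hlevel : ∀ q ∈ U ×ˢ Icc (0:ℝ) 1, R (G q) = q.1) {q : ℂ × ℝ} (hq : q ∈ U ×ˢ Icc (0:ℝ) 1)
    (w : ℂ × ℝ) :
    fderiv ℂ R (G q) (1, 0) * (fderivWithin ℝ G (U ×ˢ Icc (0:ℝ) 1) q w).1
      + fderiv ℂ R (G q) (0, 1) * (fderivWithin ℝ G (U ×ˢ Icc (0:ℝ) 1) q w).2 = w.1 := by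
  rw [← ContinuousLinearMap.apply_prod_complex]
  have hGq := ((hG.differentiableOn (by norm_num)) q hq).hasFDerivWithinAt
  have hRq := (hR.differentiableAt (hW.mem_nhds (hGW hq))).hasFDerivAt.restrictScalars ℝ
  have h1 := hRq.comp_hasFDerivWithinAt q hGq
  have h2 : HasFDerivWithinAt (R ∘ G) (ContinuousLinearMap.fst ℝ ℂ ℝ) (U ×ˢ Icc (0:ℝ) 1) q :=
    hasFDerivWithinAt_fst.congr hlevel (hlevel q hq)
  exact DFunLike.congr_fun ((uniqueDiffOn_prod_Icc hU q hq).eq h1 h2) w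

lemma isSymmSndFDerivWithinAt_prod_Icc (hU : IsOpen U)
    (hG : ContDiffOn ℝ 2 G (U ×ˢ Icc (0:ℝ) 1)) {q : ℂ × ℝ} (hq : q ∈ U ×ˢ Icc (0:ℝ) 1) :
    IsSymmSndFDerivWithinAt ℝ G (U ×ˢ Icc (0:ℝ) 1) q := by
  refine (hG q hq).isSymmSndFDerivWithinAt (by simp) (uniqueDiffOn_prod_Icc hU) ?_ hq
  rw [interior_prod_eq, closure_prod_eq, hU.interior_eq, interior_Icc,
    closure_Ioo zero_ne_one]
  exact ⟨subset_closure hq.1, hq.2⟩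

/-- The exterior derivative of the pullback of `ω`, when `dω = dR ∧ ξ`. -/
lemma fderivWithin_pullForm_sub (hW : IsOpen W) (hU : IsOpen U) {R : ℂ × ℂ → ℂ}
    (hR : DifferentiableOn ℂ R W)
    (hGW : MapsTo G (U ×ˢ Icc (0:ℝ) 1) W) (hG : ContDiffOn ℝ 2 G (U ×ˢ Icc (0:ℝ) 1))
    (hlevel : ∀ q ∈ U ×ˢ Icc (0:ℝ) 1, R (G q) = q.1) {ω ξ : Form1} (hω : HolFormOn W ω)
    (hGL : IsGLDerivOn W R ω ξ) {q : ℂ × ℝ} (hq : q ∈ U ×ˢ Icc (0:ℝ) 1) (v : ℂ) :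
    fderivWithin ℝ (pullForm G (fderivWithin ℝ G (U ×ˢ Icc (0:ℝ) 1)) ω)
        (U ×ˢ Icc (0:ℝ) 1) q (v, 0) (0, 1)
      - fderivWithin ℝ (pullForm G (fderivWithin ℝ G (U ×ˢ Icc (0:ℝ) 1)) ω)
        (U ×ˢ Icc (0:ℝ) 1) q (0, 1) (v, 0)
      = v * pullForm G (fderivWithin ℝ G (U ×ˢ Icc (0:ℝ) 1)) ξ q (0, 1) := by
  set S := U ×ˢ Icc (0:ℝ) 1 with hS
  set D := fderivWithin ℝ G S with hDdef
  have hDd : HasFDerivWithinAt D (fderivWithin ℝ D S q) S q :=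
    ((hG.fderivWithin (m := 1) (uniqueDiffOn_prod_Icc hU) (by norm_num)).differentiableOn
      (by norm_num) q hq).hasFDerivWithinAt
  have hGq : HasFDerivWithinAt G (D q) S q :=
    ((hG.differentiableOn (by norm_num)) q hq).hasFDerivWithinAt
  have hθ := ((contDiffOn_pullForm hW hU hGW hG hω).differentiableOn
    (by norm_num) q hq).hasFDerivWithinAt
  have hP := ((hω.1.differentiableAt (hW.mem_nhds (hGW hq))).hasFDerivAt.restrictScalars
    ℝ).comp_hasFDerivWithinAt q hGq
  have hQ := ((hω.2.differentiableAt (hW.mem_nhds (hGW hq))).hasFDerivAt.restrictScalars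
    ℝ).comp_hasFDerivWithinAt q hGq
  have formula : ∀ z w : ℂ × ℝ, fderivWithin ℝ (pullForm G D ω) S q z w
      = fderiv ℂ ω.1 (G q) (D q z) * (D q w).1 + ω.1 (G q) * (fderivWithin ℝ D S q z w).1
        + (fderiv ℂ ω.2 (G q) (D q z) * (D q w).2
          + ω.2 (G q) * (fderivWithin ℝ D S q z w).2) := by
    intro z w
    have h1 := hθ.clm_apply (hasFDerivWithinAt_const (𝕜 := ℝ) w q S)
    have h2 := hDd.clm_apply (hasFDerivWithinAt_const (𝕜 := ℝ) w q S)
    have h3 := (hP.mul h2.fst).add (hQ.mul h2.snd)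
    have h4 := DFunLike.congr_fun ((uniqueDiffOn_prod_Icc hU q hq).eq h1 h3) z
    simp at h4
    rw [h4]
    ring
  have hsymm : fderivWithin ℝ D S q (v, 0) (0, 1) = fderivWithin ℝ D S q (0, 1) (v, 0) :=
    isSymmSndFDerivWithinAt_prod_Icc hU hG hq (v, 0) (0, 1)
  have hv := fderiv_level_apply hW hU hR hGW hG hlevel hq (v, 0)
  have hs := fderiv_level_apply hW hU hR hGW hG hlevel hq (0, 1)
  have hd := hGL (G q) (hGW hq)
  rw [← hDdef] at hv hs
  rw [formula, formula, hsymm, pullForm_apply,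
    (fderiv ℂ ω.1 (G q)).apply_prod_complex (D q (v, 0)),
    (fderiv ℂ ω.1 (G q)).apply_prod_complex (D q (0, 1)),
    (fderiv ℂ ω.2 (G q)).apply_prod_complex (D q (v, 0)),
    (fderiv ℂ ω.2 (G q)).apply_prod_complex (D q (0, 1))]
  simp only at hv hs
  generalize D q (v, 0) = a at *
  generalize D q (0, 1) = b at *
  linear_combination (a.1 * b.2 - b.1 * a.2) * hd + (ξ.1 (G q) * b.1 + ξ.2 (G q) * b.2) * hv
    - (ξ.1 (G q) * a.1 + ξ.2 (G q) * a.2) * hs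

/-- The wedge product of the pullbacks of `ω` and `ω'`, when `ω ∧ ω' = dR ∧ ζ`. -/
lemma pullForm_wedge (hW : IsOpen W) (hU : IsOpen U) {R : ℂ × ℂ → ℂ}
    (hR : DifferentiableOn ℂ R W)
    (hGW : MapsTo G (U ×ˢ Icc (0:ℝ) 1) W) (hG : ContDiffOn ℝ 2 G (U ×ˢ Icc (0:ℝ) 1))
    (hlevel : ∀ q ∈ U ×ˢ Icc (0:ℝ) 1, R (G q) = q.1) {ω ω' ζ : Form1}
    (hwedge : ∀ p ∈ W, ω.1 p * ω'.2 p - ω.2 p * ω'.1 p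
      = fderiv ℂ R p (1, 0) * ζ.2 p - fderiv ℂ R p (0, 1) * ζ.1 p)
    {q : ℂ × ℝ} (hq : q ∈ U ×ˢ Icc (0:ℝ) 1) (v : ℂ) :
    pullForm G (fderivWithin ℝ G (U ×ˢ Icc (0:ℝ) 1)) ω q (v, 0)
        * pullForm G (fderivWithin ℝ G (U ×ˢ Icc (0:ℝ) 1)) ω' q (0, 1)
      - pullForm G (fderivWithin ℝ G (U ×ˢ Icc (0:ℝ) 1)) ω q (0, 1)
        * pullForm G (fderivWithin ℝ G (U ×ˢ Icc (0:ℝ) 1)) ω' q (v, 0)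
      = v * pullForm G (fderivWithin ℝ G (U ×ˢ Icc (0:ℝ) 1)) ζ q (0, 1) := by
  have hv := fderiv_level_apply hW hU hR hGW hG hlevel hq (v, 0)
  have hs := fderiv_level_apply hW hU hR hGW hG hlevel hq (0, 1)
  have hd := hwedge (G q) (hGW hq)
  simp only [pullForm_apply]
  simp only at hv hs
  generalize fderivWithin ℝ G (U ×ˢ Icc (0:ℝ) 1) q (v, 0) = a at *
  generalize fderivWithin ℝ G (U ×ˢ Icc (0:ℝ) 1) q (0, 1) = b at *
  linear_combination (a.1 * b.2 - b.1 * a.2) * hd + (ζ.1 (G q) * b.1 + ζ.2 (G q) * b.2) * hv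
    - (ζ.1 (G q) * a.1 + ζ.2 (G q) * a.2) * hs

/-- If `G (τ, s)` stays on `{x = 0}` and `ω` pulls back to zero there, then so does its pullback
along `τ ↦ G (τ, s)`. -/
lemma pullForm_eq_zero_of_fst_eq_zero (hU : IsOpen U)
    (hGW : MapsTo G (U ×ˢ Icc (0:ℝ) 1) W) (hG : ContDiffOn ℝ 2 G (U ×ˢ Icc (0:ℝ) 1))
    {ω : Form1} (hω : ∀ y : ℂ, ((0:ℂ), y) ∈ W → ω.2 (0, y) = 0) {s : ℝ} (hs : s ∈ Icc (0:ℝ) 1)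
    (hbase : ∀ t ∈ U, (G (t, s)).1 = 0) {t : ℂ} (ht : t ∈ U) (v : ℂ) :
    pullForm G (fderivWithin ℝ G (U ×ˢ Icc (0:ℝ) 1)) ω (t, s) (v, 0) = 0 := by
  have hq : (t, s) ∈ U ×ˢ Icc (0:ℝ) 1 := ⟨ht, hs⟩
  have h1 := (((hG.differentiableOn (by norm_num)) _ hq).hasFDerivWithinAt.hasFDerivAt_fst_slice
    hU hq).fst
  have h2 : HasFDerivAt (fun τ => (G (τ, s)).1) (0 : ℂ →L[ℝ] ℂ) t :=
    (hasFDerivAt_const (0:ℂ) t).congr_of_eventuallyEq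
      (by filter_upwards [hU.mem_nhds ht] with τ hτ using hbase τ hτ)
  have h3 : (fderivWithin ℝ G (U ×ˢ Icc (0:ℝ) 1) (t, s) (v, 0)).1 = 0 :=
    DFunLike.congr_fun (h1.unique h2) v
  have h4 : G (t, s) = (0, (G (t, s)).2) := Prod.ext (hbase t ht) rfl
  have h5 : ω.2 (G (t, s)) = 0 := by
    rw [h4]
    exact hω _ (h4 ▸ hGW hq)
  rw [pullForm_apply, h3, h5]
  simp

lemma iterInt_eq_iterPrim (hG : ContDiffOn ℝ 2 G (U ×ˢ Icc (0:ℝ) 1)) {t : ℂ} (ht : t ∈ U) :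
    ∀ (l : List Form1) {s : ℝ} (_ : s ∈ Icc (0:ℝ) 1), iterInt (fun u => G (t, u)) l s
      = iterPrim (l.map fun ω q => pullForm G (fderivWithin ℝ G (U ×ˢ Icc (0:ℝ) 1)) ω q (0, 1))
          (t, s)
  | [], _, _ => rfl
  | ω :: l, s, hs => by
    rw [iterInt, List.map_cons, iterPrim]
    refine intervalIntegral.integral_congr_Ioo_of_le hs.1 fun u hu => ?_
    have hu' : u ∈ Ioo (0:ℝ) 1 := ⟨hu.1, hu.2.trans_le hs.2⟩
    have hd := ((hG.differentiableOn (by norm_num)) (t, u)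
      ⟨ht, Ioo_subset_Icc_self hu'⟩).hasFDerivWithinAt.hasDerivAt_snd_slice ht hu'
    have hd₁ : deriv (fun r => (G (t, r)).1) u = _ := (hasFDerivAt_fst.comp_hasDerivAt u hd).deriv
    have hd₂ : deriv (fun r => (G (t, r)).2) u = _ := (hasFDerivAt_snd.comp_hasDerivAt u hd).deriv
    simp only
    rw [iterInt_eq_iterPrim hG ht l (Ioo_subset_Icc_self hu'), pullForm_apply, pull, hd₁, hd₂]
    rfl

end Pullback

/-- Differentiation of iterated integrals: for a `C²` family `Γ : U × [0,1] → W` of cycles on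
`{R = t}` with base points on `{x = 0}`, holomorphic 1-forms `ω₁, …, ω_n` whose pullbacks to
the line `{x = 0}` vanish, Gelfand–Leray derivatives `ξ_i` (`dω_i = dR ∧ ξ_i`), and forms
`ζ_i` with `ω_i ∧ ω_{i+1} = dR ∧ ζ_i`, one has (indices here `0`-based)
`d/dt ∮ ω₁⋯ω_n = Σ_{i=1}^{n} ∮ ω₁⋯ω_{i−1} ξ_i ω_{i+1}⋯ω_n
  − Σ_{i=1}^{n−1} ∮ ω₁⋯ω_{i−1} ζ_i ω_{i+2}⋯ω_n`. -/
theorem gelfand_leray_iterated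
    (W : Set (ℂ × ℂ)) (hW : IsOpen W) (R : ℂ × ℂ → ℂ) (hR : DifferentiableOn ℂ R W)
    (U : Set ℂ) (hU : IsOpen U)
    (Γ : ℂ → ℝ → ℂ × ℂ)
    (hΓW : ∀ t ∈ U, ∀ s ∈ Set.Icc (0:ℝ) 1, Γ t s ∈ W)
    (hΓ : ContDiffOn ℝ 2 (fun p : ℂ × ℝ => Γ p.1 p.2) (U ×ˢ Set.Icc (0:ℝ) 1))
    (hlevel : ∀ t ∈ U, ∀ s ∈ Set.Icc (0:ℝ) 1, R (Γ t s) = t)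
    (hloop : ∀ t ∈ U, Γ t 0 = Γ t 1)
    (hbase : ∀ t ∈ U, (Γ t 0).1 = 0)
    (n : ℕ) (ω ξ ζ : ℕ → Form1)
    (hω : ∀ i < n, HolFormOn W (ω i)) (hξ : ∀ i < n, HolFormOn W (ξ i))
    (hζ : ∀ i < n - 1, HolFormOn W (ζ i))
    (hvanish : ∀ i < n, ∀ y : ℂ, ((0:ℂ), y) ∈ W → (ω i).2 (0, y) = 0)
    (hGL : ∀ i < n, IsGLDerivOn W R (ω i) (ξ i))
    (hwedge : ∀ i < n - 1, ∀ p ∈ W,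
      (ω i).1 p * (ω (i+1)).2 p - (ω i).2 p * (ω (i+1)).1 p
        = fderiv ℂ R p (1, 0) * (ζ i).2 p - fderiv ℂ R p (0, 1) * (ζ i).1 p) :
    ∀ t ∈ U, HasDerivAt (fun τ => iterInt (Γ τ) ((List.range n).map ω) 1)
      ((∑ i ∈ Finset.range n,
          iterInt (Γ t) ((List.range n).map (Function.update ω i (ξ i))) 1)
        - ∑ i ∈ Finset.range (n - 1),
            iterInt (Γ t)
              (((List.range n).map ω).take i ++ ζ i :: ((List.range n).map ω).drop (i + 2))
              1) t := by
  intro t ht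
  set G : ℂ × ℝ → ℂ × ℂ := fun p => Γ p.1 p.2 with hGdef
  set S := U ×ˢ Icc (0:ℝ) 1 with hS
  have hGW : MapsTo G S W := fun q hq => hΓW q.1 hq.1 q.2 hq.2
  have hlev : ∀ q ∈ S, R (G q) = q.1 := fun q hq => hlevel q.1 hq.1 q.2 hq.2
  set θ : Form1 → ℂ × ℝ → (ℂ × ℝ →L[ℝ] ℂ) := pullForm G (fderivWithin ℝ G S) with hθ
  set A : Form1 → ℂ × ℝ → ℂ := fun η q => θ η q (0, 1) with hA
  have hθc : ∀ i < n, ContDiffOn ℝ 1 (θ (ω i)) S := fun i hi =>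
    contDiffOn_pullForm hW hU hGW hΓ (hω i hi)
  have h01 : (0:ℝ) ∈ Icc (0:ℝ) 1 := ⟨le_rfl, zero_le_one⟩
  have h11 : (1:ℝ) ∈ Icc (0:ℝ) 1 := ⟨zero_le_one, le_rfl⟩
  have key := hasFDerivAt_iterPrim hU n (fun i => θ (ω i))
    (fun i => fderivWithin ℝ (θ (ω i)) S) (fun i => A (ξ i)) (fun i => A (ζ i))
    (fun i hi q hq => ((hθc i hi).differentiableOn (by norm_num) q hq).hasFDerivWithinAt)
    (fun i hi => (hθc i hi).continuousOn_fderivWithin (uniqueDiffOn_prod_Icc hU) le_rfl)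
    (fun i hi => continuousOn_pullForm_apply hU hGW hΓ (hξ i hi) _)
    (fun i hi => continuousOn_pullForm_apply hU hGW hΓ (hζ i hi) _)
    (fun i hi τ hτ v => pullForm_eq_zero_of_fst_eq_zero hU hGW hΓ (hvanish i hi) h01 hbase hτ v)
    (fun i hi q hq v =>
      fderivWithin_pullForm_sub hW hU hR hGW hΓ hlev (hω i hi) (hGL i hi) hq v)
    (fun i hi q hq v => pullForm_wedge hW hU hR hGW hΓ hlev (hwedge i hi) hq v)
    (t, 1) ⟨ht, h11⟩
  have hend : tailPrim n (fun i => A (ω i)) (t, 1) •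
      (θ (ω 0) (t, 1)).comp (ContinuousLinearMap.inl ℝ ℂ ℝ) = 0 := by
    ext v
    cases n with
    | zero => simp [tailPrim]
    | succ n =>
      have h0 : θ (ω 0) (t, 1) (v, 0) = 0 :=
        pullForm_eq_zero_of_fst_eq_zero hU hGW hΓ (hvanish 0 (by omega)) h11
        (fun τ hτ => by simpa [hGdef, ← hloop τ hτ] using hbase τ hτ) ht v
      simp only [smul_apply, ContinuousLinearMap.comp_apply, ContinuousLinearMap.inl_apply,
        h0, smul_zero, zero_apply]
  have hcongr : (fun τ => iterInt (Γ τ) ((List.range n).map ω) 1) =ᶠ[𝓝 t]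
      fun τ => iterPrim ((List.range n).map fun i => A (ω i)) (τ, 1) := by
    filter_upwards [hU.mem_nhds ht] with τ hτ
    have := iterInt_eq_iterPrim hΓ hτ ((List.range n).map ω) h11
    rwa [List.map_map] at this
  have hsum : (∑ i ∈ Finset.range n,
          iterInt (Γ t) ((List.range n).map (Function.update ω i (ξ i))) 1)
        - ∑ i ∈ Finset.range (n - 1),
            iterInt (Γ t)
              (((List.range n).map ω).take i ++ ζ i :: ((List.range n).map ω).drop (i + 2)) 1
      = contractSum n (fun i => A (ω i)) (fun i => A (ξ i)) (fun i => A (ζ i)) (t, 1) := by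
    unfold contractSum
    congr 1
    · refine Finset.sum_congr rfl fun i _ => ?_
      refine (iterInt_eq_iterPrim hΓ ht _ h11).trans ?_
      rw [List.map_map]
      congr 2
      funext j
      simp only [Function.comp_apply, Function.update_apply]
      split_ifs <;> rfl
    · refine Finset.sum_congr rfl fun i _ => ?_
      refine (iterInt_eq_iterPrim hΓ ht _ h11).trans ?_
      rw [List.map_append, List.map_take, List.map_cons, List.map_drop, List.map_map]
      rfl
  rw [hsum, hasDerivAt_iff_hasFDerivAt]
  refine hasFDerivAt_of_restrictScalars ℝ (key.congr_of_eventuallyEq hcongr) ?_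
  ext v
  rw [hend]
  simp [mul_comm, hA]
end
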